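/- arXiv:0709.0243 — 3 statements merged into one kernel-verified Lean document; each statement's English description precedes it below -/
import Mathlib

section
/- Let δ ≥ 1 and q > δ. Then every weight w ∈ RH_∞^δ(I) on a bounded interval I ⊂ ℝ satisfies, for every subinterval J ⊂ I, ⟨w⟩_J · ⟨w^{1−q'}⟩_J^{q−1} ≤ (1/δ) · ((q−1)/(q−δ))^{q−1}, and this constant is the best possible. -/
open MeasureTheory Set ENNReal

/-- The average `⟨f⟩_{(a,b)}` of an `ℝ≥0∞`-valued function over an interval. -/
noncomputable def avgE (f : ℝ → ℝ≥0∞) (a b : ℝ) : ℝ≥0∞ :=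
  (∫⁻ t in Set.Ioo a b, f t) / ENNReal.ofReal (b - a)

/-- `w ∈ RH_∞^δ([A,B])`: on every subinterval, `ess sup w ≤ δ ⟨w⟩`. -/
def MemRHinf (δ A B : ℝ) (w : ℝ → ℝ≥0∞) : Prop :=
  Measurable w ∧ (∫⁻ t in Set.Ioo A B, w t) ≠ ⊤ ∧
    ∀ a b, A ≤ a → a < b → b ≤ B →
      essSup w (volume.restrict (Set.Ioo a b)) ≤ ENNReal.ofReal δ * avgE w a b

/-- To compare two measures on a bounded open subset of `ℝ` it suffices to compare them on its
connected components. -/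
theorem measure_le_measure_of_forall_component_le {μ ν : Measure ℝ} {G : Set ℝ} {a b : ℝ}
    (hG : IsOpen G) (hGab : G ⊆ Ioo a b)
    (h : ∀ c d, c < d → Ioo c d ⊆ G → c ∉ G → d ∉ G → μ (Ioo c d) ≤ ν (Ioo c d)) :
    μ G ≤ ν G := by
  set T : Set (ℝ × ℝ) := {x | x.1 < x.2 ∧ Ioo x.1 x.2 ⊆ G ∧ x.1 ∉ G ∧ x.2 ∉ G} with hT
  have hdisj : T.PairwiseDisjoint fun x => Ioo x.1 x.2 := by
    rintro ⟨c, d⟩ ⟨-, hs, hc, hd⟩ ⟨c', d'⟩ ⟨-, hs', hc', hd'⟩ hne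
    rw [Function.onFun, Set.disjoint_left]
    rintro z ⟨h1, h2⟩ ⟨h3, h4⟩
    simp only at h1 h2 h3 h4 hc hd hc' hd' hs hs'
    apply hne
    have e1 : c = c' := by
      rcases lt_trichotomy c c' with hlt | heq | hlt
      · exact absurd (hs ⟨hlt, h3.trans h2⟩) hc'
      · exact heq
      · exact absurd (hs' ⟨hlt, h1.trans h4⟩) hc
    have e2 : d = d' := by
      rcases lt_trichotomy d d' with hlt | heq | hlt
      · exact absurd (hs' ⟨h3.trans h2, hlt⟩) hd
      · exact heq
      · exact absurd (hs ⟨h1.trans h4, hlt⟩) hd'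
    rw [e1, e2]
  have hcount : T.Countable :=
    hdisj.countable_of_isOpen (fun _ _ => isOpen_Ioo) fun x hx => nonempty_Ioo.2 hx.1
  have hunion : G = ⋃ x ∈ T, Ioo x.1 x.2 := by
    refine Subset.antisymm (fun x hx => ?_) (iUnion₂_subset fun x hx => hx.2.1)
    have hxab := hGab hx
    have ha : a ∉ G := fun h => lt_irrefl _ (hGab h).1
    have hb : b ∉ G := fun h => lt_irrefl _ (hGab h).2
    have hcm : sSup (Gᶜ ∩ Iic x) ∈ Gᶜ ∩ Iic x :=
      (hG.isClosed_compl.inter isClosed_Iic).csSup_mem ⟨a, ha, hxab.1.le⟩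
        ⟨x, fun y hy => hy.2⟩
    have hdm : sInf (Gᶜ ∩ Ici x) ∈ Gᶜ ∩ Ici x :=
      (hG.isClosed_compl.inter isClosed_Ici).csInf_mem ⟨b, hb, hxab.2.le⟩
        ⟨x, fun y hy => hy.2⟩
    have hcx : sSup (Gᶜ ∩ Iic x) < x := lt_of_le_of_ne hcm.2 fun e => hcm.1 (by rwa [e])
    have hxd : x < sInf (Gᶜ ∩ Ici x) := lt_of_le_of_ne hdm.2 fun e => hdm.1 (by rwa [← e])
    refine mem_iUnion₂.2 ⟨(sSup (Gᶜ ∩ Iic x), sInf (Gᶜ ∩ Ici x)),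
      ⟨hcx.trans hxd, fun y hy => ?_, hcm.1, hdm.1⟩, hcx, hxd⟩
    by_contra hyG
    rcases le_total y x with hyx | hxy
    · exact not_le_of_gt hy.1 (le_csSup ⟨x, fun y hy => hy.2⟩ ⟨hyG, hyx⟩)
    · exact not_le_of_gt hy.2 (csInf_le ⟨x, fun y hy => hy.2⟩ ⟨hyG, hxy⟩)
  rw [hunion, measure_biUnion hcount hdisj fun _ _ => measurableSet_Ioo,
    measure_biUnion hcount hdisj fun _ _ => measurableSet_Ioo]
  exact ENNReal.tsum_le_tsum fun x => h _ _ x.2.1 x.2.2.1 x.2.2.2.1 x.2.2.2.2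

/-- The reverse Hölder condition passes from intervals to the sublevel sets of the weight. -/
theorem MemRHinf.mul_volume_sublevel_le {δ A B : ℝ} {w : ℝ → ℝ≥0∞} (hw : MemRHinf δ A B w)
    {a b : ℝ} (hAa : A ≤ a) (hab : a < b) (hbB : b ≤ B) {s : ℝ≥0∞}
    (hs : s ≤ essSup w (volume.restrict (Ioo a b))) :
    s * volume (Ioo a b ∩ {t | w t < s}) ≤
      ENNReal.ofReal δ * ∫⁻ t in Ioo a b ∩ {t | w t < s}, w t := by
  obtain ⟨hm, hfin, hRH⟩ := hw
  have hRH' : ∀ c d, a ≤ c → c < d → d ≤ b → s ≤ essSup w (volume.restrict (Ioo c d)) →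
      s * volume (Ioo c d) ≤ ENNReal.ofReal δ * ∫⁻ t in Ioo c d, w t := by
    intro c d hac hcd hdb hsE
    have h1 := hsE.trans (hRH c d (hAa.trans hac) hcd (hdb.trans hbB))
    rw [avgE, ← mul_div_assoc, ENNReal.le_div_iff_mul_le
      (Or.inl (by simpa using hcd)) (Or.inl ENNReal.ofReal_ne_top)] at h1
    rwa [Real.volume_Ioo]
  set ρ : Measure ℝ := volume.restrict (Ioo a b ∩ {t | s ≤ w t}) with hρ
  have hmle : MeasurableSet {t | s ≤ w t} := hm measurableSet_Ici
  have hmlt : MeasurableSet {t | w t < s} := hm measurableSet_Iio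
  have hess : ∀ c d x, a ≤ c → d ≤ b → x ∈ ρ.support → x ∈ Ioo c d →
      s ≤ essSup w (volume.restrict (Ioo c d)) := by
    intro c d x hac hdb hx hxcd
    by_contra! hlt
    have h0 := (Measure.mem_support_iff_forall x).1 hx _ (Ioo_mem_nhds hxcd.1 hxcd.2)
    have h1 := ae_lt_of_essSup_lt hlt
    rw [ae_restrict_iff' measurableSet_Ioo] at h1
    refine h0.ne' ?_
    rw [hρ, Measure.restrict_apply measurableSet_Ioo]
    refine measure_mono_null ?_ (ae_iff.1 h1)
    rintro t ⟨ht, -, ht'⟩ h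
    exact absurd (h ht) (not_lt_of_ge ht')
  set ν : Measure ℝ :=
    ENNReal.ofReal δ • (volume.restrict (Ioo a b)).withDensity w with hν
  have hνapp : ∀ S, MeasurableSet S → S ⊆ Ioo a b → ν S = ENNReal.ofReal δ * ∫⁻ t in S, w t := by
    intro S hS hSab
    rw [hν, Measure.smul_apply, withDensity_apply _ hS, Measure.restrict_restrict hS,
      inter_eq_self_of_subset_left hSab, smul_eq_mul]
  have hfin' : (∫⁻ t in Ioo a b, w t) ≠ ⊤ :=
    ne_top_of_le_ne_top hfin (lintegral_mono_set (Ioo_subset_Ioo hAa hbB))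
  have : IsFiniteMeasure ν := by
    have := isFiniteMeasure_withDensity hfin'
    rw [hν]
    exact Measure.smul_finite _ ENNReal.ofReal_ne_top
  have hopen : ∀ G, IsOpen G → Ioo a b ∩ ({t | w t < s} ∪ ρ.supportᶜ) ⊆ G → G ⊆ Ioo a b →
      (s • volume) G ≤ ν G := by
    intro G hG hsub hGab
    refine measure_le_measure_of_forall_component_le hG hGab fun c d hcd hsubG hc hd => ?_
    have hac : a ≤ c := by
      by_contra! h
      have h2 := lt_min h hcd
      have h3 := min_le_left a d
      have h4 := min_le_right a d
      have := hGab (hsubG (show (c + min a d) / 2 ∈ Ioo c d from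
        ⟨by linarith, by linarith⟩))
      linarith [this.1]
    have hdb : d ≤ b := by
      by_contra! h
      have h2 := max_lt h hcd
      have h3 := le_max_left b c
      have h4 := le_max_right b c
      have := hGab (hsubG (show (d + max b c) / 2 ∈ Ioo c d from ⟨by linarith, by linarith⟩))
      linarith [this.2]
    have hsupp : ∀ x, x ∈ Ioo a b → x ∉ G → x ∈ ρ.support := fun x hx hxG => by
      by_contra h
      exact hxG (hsub ⟨hx, Or.inr h⟩)
    have hIcc : ν (Ioo c d) = ν (Icc c d) := by
      refine measure_congr ?_
      have : ν ≪ volume := (Measure.smul_absolutelyContinuous).trans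
        ((withDensity_absolutelyContinuous _ _).trans Measure.restrict_le_self.absolutelyContinuous)
      exact this.ae_le Ioo_ae_eq_Icc
    rw [hIcc, (Icc c d).measure_eq_iInf_isOpen ν]
    refine le_iInf₂ fun V hV => le_iInf fun hVo => ?_
    obtain ⟨c', d', hac', hc', hd', hdb', hV', hess'⟩ : ∃ c' d', a ≤ c' ∧ c' ≤ c ∧ d ≤ d' ∧ d' ≤ b ∧
        Ioo c' d' ⊆ V ∧ s ≤ essSup w (volume.restrict (Ioo c' d')) := by
      rcases hac.eq_or_lt with rfl | hac
      · rcases hdb.eq_or_lt with rfl | hdb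
        · exact ⟨a, d, le_rfl, le_rfl, le_rfl, le_rfl, Ioo_subset_Icc_self.trans hV, hs⟩
        · obtain ⟨u, hu, hu'⟩ := exists_Ico_subset_of_mem_nhds
            (hVo.mem_nhds (hV (right_mem_Icc.2 hcd.le))) (exists_gt d)
          have hlt : d < min u b := lt_min hu hdb
          refine ⟨a, min u b, le_rfl, le_rfl, hlt.le, min_le_right _ _, fun y hy => ?_,
            hess _ _ d le_rfl (min_le_right _ _) (hsupp d ⟨hcd, hdb⟩ hd) ⟨hcd, hlt⟩⟩
          rcases lt_or_ge y d with h | h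
          · exact hV ⟨hy.1.le, h.le⟩
          · exact hu' ⟨h, hy.2.trans_le (min_le_left _ _)⟩
      · obtain ⟨l, hl, hl'⟩ := exists_Ioc_subset_of_mem_nhds
            (hVo.mem_nhds (hV (left_mem_Icc.2 hcd.le))) (exists_lt c)
        have hlt : max l a < c := max_lt hl hac
        refine ⟨max l a, d, le_max_right _ _, hlt.le, le_rfl, hdb, fun y hy => ?_,
            hess _ _ c (le_max_right _ _) hdb (hsupp c ⟨hac, hcd.trans_le hdb⟩ hc) ⟨hlt, hcd⟩⟩
        rcases lt_or_ge c y with h | h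
        · exact hV ⟨h.le, hy.2.le⟩
        · exact hl' ⟨(le_max_left _ _).trans_lt hy.1, h⟩
    calc (s • volume) (Ioo c d) ≤ s * volume (Ioo c' d') := by
          rw [Measure.smul_apply, smul_eq_mul]
          gcongr
      _ ≤ ENNReal.ofReal δ * ∫⁻ t in Ioo c' d', w t :=
          hRH' c' d' hac' (by linarith) hdb' hess'
      _ = ν (Ioo c' d') := (hνapp _ measurableSet_Ioo (Ioo_subset_Ioo hac' hdb')).symm
      _ ≤ ν V := measure_mono hV'
  have hnull : volume (Ioo a b ∩ {t | s ≤ w t} ∩ ρ.supportᶜ) = 0 := by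
    have h := Measure.measure_compl_support (μ := ρ)
    rwa [hρ, Measure.restrict_apply Measure.isOpen_compl_support.measurableSet, inter_comm,
      ← hρ] at h
  have haeeq : (Ioo a b ∩ ({t | w t < s} ∪ ρ.supportᶜ) : Set ℝ) =ᵐ[volume]
      (Ioo a b ∩ {t | w t < s} : Set ℝ) := by
    refine (ae_le_set.2 (measure_mono_null ?_ hnull)).antisymm
      (LE.le.eventuallyLE fun x hx => ⟨hx.1, Or.inl hx.2⟩)
    rintro x ⟨⟨hx, hx'⟩, hn⟩
    have : s ≤ w x := by
      by_contra! h
      exact hn ⟨hx, h⟩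
    rcases hx' with h | h
    · exact absurd ⟨hx, h⟩ hn
    · exact ⟨⟨hx, this⟩, h⟩
  have hmeas : MeasurableSet (Ioo a b ∩ ({t | w t < s} ∪ ρ.supportᶜ)) :=
    measurableSet_Ioo.inter (hmlt.union Measure.isOpen_compl_support.measurableSet)
  rw [← measure_congr haeeq, ← setLIntegral_congr haeeq,
    ← hνapp _ hmeas inter_subset_left, Set.measure_eq_iInf_isOpen _ ν]
  refine le_iInf₂ fun V hV => le_iInf fun hVo => ?_
  calc s * volume (Ioo a b ∩ ({t | w t < s} ∪ ρ.supportᶜ))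
      ≤ (s • volume) (V ∩ Ioo a b) := by
        rw [Measure.smul_apply, smul_eq_mul]
        exact mul_le_mul' le_rfl (measure_mono (subset_inter hV inter_subset_left))
    _ ≤ ν (V ∩ Ioo a b) := hopen _ (hVo.inter isOpen_Ioo)
        (subset_inter hV inter_subset_left) inter_subset_right
    _ ≤ ν V := measure_mono inter_subset_left

/-- Integrated form of a sublevel set inequality `t μ{u < t} ≤ δ ∫_{u < t} u`. -/
theorem integral_max_rpow_le_of_sublevel {μ : Measure ℝ} [IsFiniteMeasure μ] {u : ℝ → ℝ}
    (hu : Measurable u) {m ε p δ : ℝ} (hu0 : ∀ x, 0 ≤ u x) (hum : ∀ x, u x ≤ m) (hε : 0 < ε)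
    (hεm : ε < m) (hp : 0 < p) (hδ : 0 ≤ δ)
    (h : ∀ t, 0 < t → t < m → 0 ≤ ∫ x in {x | u x < t}, (δ * u x - t) ∂μ) :
    (1 / p - δ / (p + 1)) * ∫ x, max (u x) ε ^ (-p) ∂μ ≤
      m ^ (-p) / p * μ.real univ - δ / (p + 1) * m ^ (-p - 1) * ∫ x, u x ∂μ := by
  have hm : 0 < m := hε.trans hεm
  set F : ℝ → ℝ → ℝ := fun x t =>
    if u x < t then t ^ (-p - 2) * (δ * u x - t) else 0 with hF
  have hFm : Measurable (Function.uncurry F) := by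
    refine Measurable.ite ?_ ?_ measurable_const
    · exact measurableSet_lt (hu.comp measurable_fst) measurable_snd
    · exact (measurable_snd.pow_const _).mul
        (((hu.comp measurable_fst).const_mul δ).sub measurable_snd)
  have hFint : Integrable (Function.uncurry F) (μ.prod (volume.restrict (Ioo ε m))) := by
    refine Integrable.of_bound (C := ε ^ (-p - 2) * (δ * m + m)) hFm.aestronglyMeasurable ?_
    have hmem : ∀ᵐ z ∂(μ.prod (volume.restrict (Ioo ε m))), z.2 ∈ Ioo ε m :=
      Measure.quasiMeasurePreserving_snd.ae (ae_restrict_mem measurableSet_Ioo)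
    filter_upwards [hmem] with z hz
    have hz0 : 0 < z.2 := hε.trans hz.1
    have hb : (0 : ℝ) ≤ ε ^ (-p - 2) * (δ * m + m) := by positivity
    simp only [Function.uncurry, hF]
    split_ifs with hlt
    · rw [norm_mul, Real.norm_of_nonneg (by positivity)]
      refine mul_le_mul (Real.rpow_le_rpow_of_nonpos hε hz.1.le (by linarith)) ?_ (norm_nonneg _)
        (by positivity)
      have h1 := mul_le_mul_of_nonneg_left (hum z.1) hδ
      have h2 := mul_nonneg hδ (hu0 z.1)
      rw [Real.norm_eq_abs, abs_le]
      constructor <;> linarith [hz.2]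
    · simpa using hb
  have hswap : ∫ x, ∫ t in Ioo ε m, F x t ∂volume ∂μ = ∫ t in Ioo ε m, ∫ x, F x t ∂μ :=
    integral_integral_swap hFint
  have hnonneg : 0 ≤ ∫ t in Ioo ε m, ∫ x, F x t ∂μ := by
    refine setIntegral_nonneg measurableSet_Ioo fun t ht => ?_
    have ht0 : 0 < t := hε.trans ht.1
    have : ∫ x, F x t ∂μ = t ^ (-p - 2) * ∫ x in {x | u x < t}, (δ * u x - t) ∂μ := by
      rw [← integral_const_mul, ← integral_indicator (measurableSet_lt hu measurable_const)]
      rfl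
    rw [this]
    exact mul_nonneg (by positivity) (h t ht0 ht.2)
  have hinner : ∀ x, ∫ t in Ioo ε m, F x t ≤
      δ / (p + 1) * max (u x) ε ^ (-p) - δ / (p + 1) * m ^ (-p - 1) * u x
        - (max (u x) ε ^ (-p) - m ^ (-p)) / p := by
    intro x
    set y := max (u x) ε with hy
    have hyε : ε ≤ y := le_max_right _ _
    have hy0 : 0 < y := hε.trans_le hyε
    have hym : y ≤ m := max_le (hum x) hεm.le
    have h1 : ∫ t in Ioo ε m, F x t = ∫ t in y..m, (δ * u x * t ^ (-p - 2) - t ^ (-p - 1)) := by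
      rw [intervalIntegral.integral_of_le hym, integral_Ioc_eq_integral_Ioo,
        ← integral_indicator measurableSet_Ioo, ← integral_indicator measurableSet_Ioo]
      refine integral_congr_ae ?_
      filter_upwards [compl_mem_ae_iff.2 (measure_singleton y)] with t hty
      have hty : t ≠ y := hty
      by_cases hty' : y < t ∧ t < m
      · have ht0 : 0 < t := hy0.trans hty'.1
        rw [indicator_of_mem (show t ∈ Ioo ε m from ⟨hyε.trans_lt hty'.1, hty'.2⟩),
          indicator_of_mem (show t ∈ Ioo y m from hty')]
        simp only [hF, if_pos ((le_max_left (u x) ε).trans_lt hty'.1)]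
        rw [show -p - 1 = (-p - 2) + 1 by ring, Real.rpow_add ht0, Real.rpow_one]
        ring
      · rw [indicator_of_notMem (show t ∉ Ioo y m from hty')]
        by_cases ht : t ∈ Ioo ε m
        · rw [indicator_of_mem ht]
          simp only [hF]
          rw [if_neg]
          intro hut
          exact hty' ⟨max_lt hut ht.1, ht.2⟩
        · rw [indicator_of_notMem ht]
    have h0 : (0 : ℝ) ∉ uIcc y m := by
      rw [uIcc_of_le hym]
      exact fun h => not_lt_of_ge h.1 hy0
    have e1 : u x * y ^ (-p - 1) ≤ y ^ (-p) := by
      have : y ^ (-p) = y * y ^ (-p - 1) := by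
        rw [show -p = (-p - 1) + 1 by ring, Real.rpow_add hy0, Real.rpow_one]
        ring_nf
      rw [this]
      exact mul_le_mul_of_nonneg_right (le_max_left _ _) (by positivity)
    rw [h1, intervalIntegral.integral_sub
      ((intervalIntegral.intervalIntegrable_rpow (Or.inr h0)).const_mul _)
      (intervalIntegral.intervalIntegrable_rpow (Or.inr h0)),
      intervalIntegral.integral_const_mul, integral_rpow (Or.inr ⟨by linarith, h0⟩),
      integral_rpow (Or.inr ⟨by linarith, h0⟩), show -p - 2 + 1 = -p - 1 by ring,
      show -p - 1 + 1 = -p by ring]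
    have e2 : δ * u x * ((m ^ (-p - 1) - y ^ (-p - 1)) / (-p - 1)) =
        δ / (p + 1) * (u x * y ^ (-p - 1)) - δ / (p + 1) * m ^ (-p - 1) * u x := by
      have : -p - 1 ≠ 0 := by linarith
      have : p + 1 ≠ 0 := by linarith
      field_simp
      ring
    have e3 : (m ^ (-p) - y ^ (-p)) / -p = (y ^ (-p) - m ^ (-p)) / p := by
      field_simp
      ring
    rw [e2, e3]
    have := mul_le_mul_of_nonneg_left e1 (show 0 ≤ δ / (p + 1) by positivity)
    linarith
  have iu : Integrable u μ := Integrable.of_bound (C := m) hu.aestronglyMeasurable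
    (ae_of_all _ fun x => by rw [Real.norm_of_nonneg (hu0 x)]; exact hum x)
  have iy : Integrable (fun x => max (u x) ε ^ (-p)) μ := by
    refine Integrable.of_bound (C := ε ^ (-p))
      ((hu.max measurable_const).pow_const _).aestronglyMeasurable (ae_of_all _ fun x => ?_)
    have : 0 < max (u x) ε := hε.trans_le (le_max_right _ _)
    rw [Real.norm_of_nonneg (by positivity)]
    exact Real.rpow_le_rpow_of_nonpos hε (le_max_right _ _) (by linarith)
  have i1 : Integrable (fun x => δ / (p + 1) * max (u x) ε ^ (-p)) μ := iy.const_mul _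
  have i2 : Integrable (fun x => δ / (p + 1) * m ^ (-p - 1) * u x) μ := iu.const_mul _
  have i12 : Integrable
      (fun x => δ / (p + 1) * max (u x) ε ^ (-p) - δ / (p + 1) * m ^ (-p - 1) * u x) μ := i1.sub i2
  have i3 : Integrable (fun x => (max (u x) ε ^ (-p) - m ^ (-p)) / p) μ :=
    (iy.sub (integrable_const _)).div_const p
  have hle : ∫ x, ∫ t in Ioo ε m, F x t ∂volume ∂μ ≤ _ :=
    integral_mono hFint.integral_prod_left (i12.sub i3) hinner
  simp only [Pi.sub_apply] at hle
  rw [integral_sub i12 i3, integral_sub i1 i2, integral_const_mul, integral_const_mul,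
    integral_div, integral_sub iy (integrable_const _), integral_const, smul_eq_mul] at hle
  rw [← hswap] at hnonneg
  have h3 := hnonneg.trans hle
  rw [sub_div] at h3
  have e : (1 / p - δ / (p + 1)) * ∫ x, max (u x) ε ^ (-p) ∂μ =
    (∫ x, max (u x) ε ^ (-p) ∂μ) / p - δ / (p + 1) * ∫ x, max (u x) ε ^ (-p) ∂μ := by ring
  have e' : μ.real univ * m ^ (-p) / p = m ^ (-p) / p * μ.real univ := by ring
  linarith

/-- Bernoulli's inequality for negative exponents. -/
theorem one_sub_mul_sub_one_le_rpow_neg {s p : ℝ} (hs : 0 < s) (hp : 0 ≤ p) :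
    1 - p * (s - 1) ≤ s ^ (-p) := by
  rw [Real.rpow_def_of_pos hs]
  have h1 := Real.add_one_le_exp (Real.log s * -p)
  have h2 := mul_le_mul_of_nonneg_left (Real.log_le_sub_one_of_pos hs) hp
  linarith

/-- The right-hand side of the sublevel estimate is largest when `m = δ * X`. -/
theorem sublevel_bound_le {q δ m X : ℝ} (hq : 1 < q) (hδ : 0 < δ) (hm : 0 < m) (hX : 0 < X) :
    m ^ (-(1 / (q - 1))) * (1 - δ * X / (q * m)) ≤
      (δ * X) ^ (-(1 / (q - 1))) * ((q - 1) / q) := by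
  set p := 1 / (q - 1) with hp
  have hq1 : 0 < q - 1 := by linarith
  have hp0 : 0 < p := by positivity
  have hs : 0 < δ * X / m := by positivity
  have h := mul_le_mul_of_nonneg_right (one_sub_mul_sub_one_le_rpow_neg hs hp0.le)
    (show 0 ≤ (q - 1) / q by positivity)
  have e1 : (1 - p * (δ * X / m - 1)) * ((q - 1) / q) = 1 - δ * X / (q * m) := by
    rw [hp]
    field_simp
    ring
  have e2 : δ * X = m * (δ * X / m) := by field_simp
  rw [e1] at h
  conv_rhs => rw [e2, Real.mul_rpow hm.le hs.le, mul_assoc]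
  exact mul_le_mul_of_nonneg_left h (by positivity)

theorem lintegral_Ioo_ofReal_rpow {a b r : ℝ} (hab : a ≤ b) (ha : 0 ≤ a) (hr : -1 < r) :
    ∫⁻ t in Ioo a b, ENNReal.ofReal (t ^ r) =
      ENNReal.ofReal ((b ^ (r + 1) - a ^ (r + 1)) / (r + 1)) := by
  have hi : IntegrableOn (fun t : ℝ => t ^ r) (Ioo a b) :=
    ((intervalIntegrable_iff_integrableOn_Ioc_of_le hab).1
      (intervalIntegral.intervalIntegrable_rpow' hr)).mono_set Ioo_subset_Ioc_self
  rw [← integral_rpow (Or.inl hr), intervalIntegral.integral_of_le hab,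
    integral_Ioc_eq_integral_Ioo, ofReal_integral_eq_lintegral_ofReal hi]
  filter_upwards [ae_restrict_mem measurableSet_Ioo] with t ht
  exact Real.rpow_nonneg (ha.trans ht.1.le) r

/-- The power weight `t ^ (δ - 1)` belongs to `RH_∞^δ([0, 1])`. -/
theorem memRHinf_rpow {δ : ℝ} (hδ : 1 ≤ δ) :
    MemRHinf δ 0 1 fun t => ENNReal.ofReal (t ^ (δ - 1)) := by
  have hδ0 : 0 < δ := by linarith
  refine ⟨by fun_prop, ?_, fun a b ha hab hb => ?_⟩
  · rw [lintegral_Ioo_ofReal_rpow zero_le_one le_rfl (by linarith)]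
    exact ENNReal.ofReal_ne_top
  · have hb0 : 0 < b := ha.trans_lt hab
    have hL : 0 < b - a := by linarith
    rw [avgE, lintegral_Ioo_ofReal_rpow hab.le ha (by linarith), ← ENNReal.ofReal_div_of_pos hL,
      ← ENNReal.ofReal_mul hδ0.le]
    refine essSup_le_of_ae_le _ ?_
    filter_upwards [ae_restrict_mem measurableSet_Ioo] with t ht
    refine ENNReal.ofReal_le_ofReal ?_
    have h1 : t ^ (δ - 1) ≤ b ^ (δ - 1) :=
      Real.rpow_le_rpow (ha.trans ht.1.le) ht.2.le (by linarith)
    refine h1.trans ?_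
    have e : δ * ((b ^ (δ - 1 + 1) - a ^ (δ - 1 + 1)) / (δ - 1 + 1) / (b - a)) =
        (b ^ (δ - 1 + 1) - a ^ (δ - 1 + 1)) / (b - a) := by
      rw [sub_add_cancel]
      field_simp
    rw [e, le_div_iff₀ hL, Real.rpow_add_one' hb0.le (by linarith),
      Real.rpow_add_one' ha (by linarith)]
    have := mul_le_mul_of_nonneg_right
      (Real.rpow_le_rpow ha hab.le (show 0 ≤ δ - 1 by linarith)) ha
    linarith

/-- The power weight `t ^ (δ - 1)` attains the extremal value on `[0, 1]`. -/
theorem avgE_rpow_mul_avgE_rpow {δ q : ℝ} (hδ : 1 ≤ δ) (hq : δ < q) :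
    avgE (fun t => ENNReal.ofReal (t ^ (δ - 1))) 0 1 *
        (avgE (fun t => ENNReal.ofReal (t ^ (δ - 1)) ^ (1 - q / (q - 1))) 0 1) ^ (q - 1) =
      ENNReal.ofReal ((1 / δ) * ((q - 1) / (q - δ)) ^ (q - 1)) := by
  have hδ0 : 0 < δ := by linarith
  have hq1 : 0 < q - 1 := by linarith
  have hqδ : 0 < q - δ := by linarith
  set r := (δ - 1) * (1 - q / (q - 1)) with hr
  have hr1 : r + 1 = (q - δ) / (q - 1) := by
    rw [hr]
    field_simp
    ring
  have hr0 : 0 < r + 1 := by rw [hr1]; positivity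
  have h1 : ∫⁻ t in Ioo (0 : ℝ) 1, ENNReal.ofReal (t ^ (δ - 1)) ^ (1 - q / (q - 1)) =
      ∫⁻ t in Ioo (0 : ℝ) 1, ENNReal.ofReal (t ^ r) := by
    refine setLIntegral_congr_fun measurableSet_Ioo fun t ht => ?_
    have ht0 : 0 < t := ht.1
    rw [ENNReal.ofReal_rpow_of_pos (by positivity), ← Real.rpow_mul ht0.le]
  rw [avgE, avgE, h1, lintegral_Ioo_ofReal_rpow zero_le_one le_rfl (by linarith),
    lintegral_Ioo_ofReal_rpow zero_le_one le_rfl (by linarith), hr1, sub_add_cancel,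
    Real.one_rpow, Real.one_rpow, Real.zero_rpow hδ0.ne',
    Real.zero_rpow (by positivity)]
  simp only [sub_zero, ENNReal.ofReal_one, div_one]
  rw [ENNReal.ofReal_rpow_of_pos (by positivity), ← ENNReal.ofReal_mul (by positivity), one_div_div]

/-- The average of `u ^ (-1 / (q - 1))` is controlled for every weight whose sublevel sets satisfy
`t μ{u < t} ≤ δ ∫_{u < t} u`. -/
theorem lintegral_rpow_neg_le_of_sublevel {μ : Measure ℝ} [IsFiniteMeasure μ] {u : ℝ → ℝ}
    (hu : Measurable u) {m q δ X : ℝ} (hu0 : ∀ x, 0 ≤ u x) (hum : ∀ x, u x ≤ m) (hm : 0 < m)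
    (hδ : 1 ≤ δ) (hq : δ < q) (hX : 0 < X) (hXu : ∫ x, u x ∂μ = X * μ.real univ)
    (h : ∀ t, 0 < t → t < m → 0 ≤ ∫ x in {x | u x < t}, (δ * u x - t) ∂μ) :
    ∫⁻ x, ENNReal.ofReal (u x) ^ (-(1 / (q - 1))) ∂μ ≤
      ENNReal.ofReal (((δ * X) ^ (-(1 / (q - 1))) * ((q - 1) / (q - δ))) * μ.real univ) := by
  have hq1 : 0 < q - 1 := by linarith
  have hqδ : 0 < q - δ := by linarith
  have hδ0 : 0 < δ := by linarith
  set p := 1 / (q - 1) with hp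
  have hp0 : 0 < p := by positivity
  set ε : ℕ → ℝ := fun n => m / (n + 2) with hεdef
  have hε : ∀ n, 0 < ε n := fun n => by positivity
  have hεm : ∀ n, ε n < m := fun n => by
    rw [hεdef]
    exact div_lt_self hm (by have : (0 : ℝ) ≤ n := n.cast_nonneg; linarith)
  have hεlim : Filter.Tendsto ε Filter.atTop (nhds 0) := by
    have := (tendsto_const_div_atTop_nhds_zero_nat m).comp (Filter.tendsto_add_atTop_nat 2)
    refine this.congr fun n => ?_
    simp [hεdef]
  have hεanti : Antitone ε := fun i j hij => by
    have : (i : ℝ) ≤ j := Nat.cast_le.2 hij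
    simp only [hεdef]
    gcongr
  have hbound : ∀ n, ∫⁻ x, ENNReal.ofReal (max (u x) (ε n)) ^ (-p) ∂μ ≤
      ENNReal.ofReal (((δ * X) ^ (-p) * ((q - 1) / (q - δ))) * μ.real univ) := by
    intro n
    have hpos : ∀ x, 0 < max (u x) (ε n) := fun x => (hε n).trans_le (le_max_right _ _)
    have iy : Integrable (fun x => max (u x) (ε n) ^ (-p)) μ := by
      refine Integrable.of_bound (C := ε n ^ (-p))
        ((hu.max measurable_const).pow_const _).aestronglyMeasurable (ae_of_all _ fun x => ?_)
      rw [Real.norm_of_nonneg (Real.rpow_nonneg (hpos x).le _)]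
      exact Real.rpow_le_rpow_of_nonpos (hε n) (le_max_right _ _) (by linarith)
    have e : ∀ x, ENNReal.ofReal (max (u x) (ε n)) ^ (-p) =
        ENNReal.ofReal (max (u x) (ε n) ^ (-p)) := fun x =>
      ENNReal.ofReal_rpow_of_pos (hpos x)
    simp_rw [e]
    rw [← ofReal_integral_eq_lintegral_ofReal iy
      (ae_of_all _ fun x => Real.rpow_nonneg (hpos x).le _)]
    refine ENNReal.ofReal_le_ofReal ?_
    have hmain := integral_max_rpow_le_of_sublevel hu hu0 hum (hε n) (hεm n) hp0 hδ0.le h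
    have hlev := sublevel_bound_le (q := q) (by linarith) hδ0 hm hX
    rw [← hp] at hlev
    have hq0 : 0 < q := by linarith
    have hp1 : p + 1 = q * p := by
      rw [hp]
      field_simp
      ring
    have hc : 1 / p - δ / (p + 1) = (q - δ) / (q * p) := by
      rw [hp1]
      field_simp
    have hr : m ^ (-p) / p * μ.real univ - δ / (p + 1) * m ^ (-p - 1) * ∫ x, u x ∂μ =
        μ.real univ / p * (m ^ (-p) * (1 - δ * X / (q * m))) := by
      rw [hXu, hp1, Real.rpow_sub_one hm.ne']
      field_simp
    rw [hc, hr] at hmain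
    have h2 := hmain.trans (mul_le_mul_of_nonneg_left hlev
      (show 0 ≤ μ.real univ / p by positivity))
    have h3 := mul_le_mul_of_nonneg_left h2 (show 0 ≤ q * p / (q - δ) by positivity)
    have e1 : q * p / (q - δ) * ((q - δ) / (q * p) * ∫ x, max (u x) (ε n) ^ (-p) ∂μ) =
        ∫ x, max (u x) (ε n) ^ (-p) ∂μ := by field_simp
    have e2 : q * p / (q - δ) * (μ.real univ / p * ((δ * X) ^ (-p) * ((q - 1) / q))) =
        (δ * X) ^ (-p) * ((q - 1) / (q - δ)) * μ.real univ := by field_simp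
    rwa [e1, e2] at h3
  refine le_of_tendsto' (lintegral_tendsto_of_tendsto_of_monotone
    (f := fun n x => ENNReal.ofReal (max (u x) (ε n)) ^ (-p)) (fun n => ?_) ?_ ?_) hbound
  · exact ((hu.max measurable_const).ennreal_ofReal.pow_const _).aemeasurable
  · refine ae_of_all _ fun x i j hij => ?_
    simp only [ENNReal.rpow_neg]
    gcongr
    exact hεanti hij
  · refine ae_of_all _ fun x => ?_
    have h1 : Filter.Tendsto (fun n => max (u x) (ε n)) Filter.atTop (nhds (u x)) := by
      simpa [hu0 x] using (tendsto_const_nhds (x := u x)).max hεlim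
    exact (ENNReal.continuous_rpow_const.tendsto _).comp (ENNReal.tendsto_ofReal h1)

theorem MemRHinf.avgE_mul_avgE_rpow_le {δ q A B : ℝ} (hδ : 1 ≤ δ) (hq : δ < q)
    {w : ℝ → ℝ≥0∞} (hw : MemRHinf δ A B w) {a b : ℝ} (hAa : A ≤ a) (hab : a < b) (hbB : b ≤ B) :
    avgE w a b * (avgE (fun t => w t ^ (1 - q / (q - 1))) a b) ^ (q - 1)
      ≤ ENNReal.ofReal ((1 / δ) * ((q - 1) / (q - δ)) ^ (q - 1)) := by
  have hq1 : 0 < q - 1 := by linarith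
  have hqδ : 0 < q - δ := by linarith
  have hδ0 : 0 < δ := by linarith
  have hL : 0 < b - a := by linarith
  have hfin : (∫⁻ t in Ioo a b, w t) ≠ ⊤ :=
    ne_top_of_le_ne_top hw.2.1 (lintegral_mono_set (Ioo_subset_Ioo hAa hbB))
  set μ : Measure ℝ := volume.restrict (Ioo a b) with hμ
  have hμL : μ.real univ = b - a := by
    simp [hμ, measureReal_def, hL.le]
  set M := essSup w μ with hM
  have hMle : M ≤ ENNReal.ofReal δ * avgE w a b := hw.2.2 a b hAa hab hbB
  rcases eq_or_ne (∫⁻ t in Ioo a b, w t) 0 with h0 | h0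
  · simp [avgE, h0]
  have hM0 : M ≠ 0 := by
    intro hM0
    apply h0
    rw [lintegral_eq_zero_iff hw.1]
    filter_upwards [ENNReal.ae_le_essSup (μ := μ) w] with x hx
    simpa [← hM, hM0] using hx
  have havg_top : avgE w a b ≠ ⊤ := ENNReal.div_ne_top hfin (by simpa using hab)
  have hMtop : M ≠ ⊤ := ne_top_of_le_ne_top (ENNReal.mul_ne_top ENNReal.ofReal_ne_top havg_top) hMle
  set m := M.toReal with hm
  have hm0 : 0 < m := ENNReal.toReal_pos hM0 hMtop
  set u : ℝ → ℝ := fun x => (min (w x) M).toReal with hu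
  have hmintop : ∀ x, min (w x) M ≠ ⊤ := fun x => ne_top_of_le_ne_top hMtop (min_le_right _ _)
  have hum : Measurable u := (hw.1.min measurable_const).ennreal_toReal
  have hu0 : ∀ x, 0 ≤ u x := fun x => ENNReal.toReal_nonneg
  have hule : ∀ x, u x ≤ m := fun x => ENNReal.toReal_mono hMtop (min_le_right _ _)
  have hwu : ∀ᵐ x ∂μ, w x = ENNReal.ofReal (u x) := by
    filter_upwards [ENNReal.ae_le_essSup (μ := μ) w] with x hx
    rw [hu]
    simp only
    rw [ENNReal.ofReal_toReal (hmintop x), min_eq_left hx]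
  have hui : Integrable u μ := Integrable.of_bound (C := m) hum.aestronglyMeasurable
    (ae_of_all _ fun x => by rw [Real.norm_of_nonneg (hu0 x)]; exact hule x)
  have hlin : ∀ S, ∫⁻ x in S, w x ∂μ = ENNReal.ofReal (∫ x in S, u x ∂μ) := fun S => by
    rw [ofReal_integral_eq_lintegral_ofReal hui.integrableOn (ae_of_all _ hu0)]
    exact lintegral_congr_ae (ae_restrict_of_ae hwu)
  have hlin' : ∫⁻ x, w x ∂μ = ENNReal.ofReal (∫ x, u x ∂μ) := by
    simpa using hlin univ
  set X := (∫ x, u x ∂μ) / (b - a) with hXdef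
  have havg : avgE w a b = ENNReal.ofReal X := by
    rw [avgE, ← hμ, hlin', ENNReal.ofReal_div_of_pos hL]
  have hX : 0 < X := by
    refine div_pos ?_ hL
    by_contra! h
    exact h0 (hlin'.trans (ENNReal.ofReal_of_nonpos h))
  have hsub : ∀ t, 0 < t → t < m → 0 ≤ ∫ x in {x | u x < t}, (δ * u x - t) ∂μ := by
    intro t ht htm
    have htM : ENNReal.ofReal t < M := (ENNReal.ofReal_lt_iff_lt_toReal ht.le hMtop).2 htm
    have hset : {x | u x < t} = {x | w x < ENNReal.ofReal t} := by
      ext x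
      simp only [mem_ofPred_eq, hu]
      rw [← ENNReal.lt_ofReal_iff_toReal_lt (hmintop x), min_lt_iff]
      simp [htM.le]
    have hS : MeasurableSet {x | u x < t} := measurableSet_lt hum measurable_const
    have key := hw.mul_volume_sublevel_le hAa hab hbB htM.le
    rw [← hset, inter_comm, ← Measure.restrict_restrict hS, ← Measure.restrict_apply hS, ← hμ,
      hlin, ← ENNReal.ofReal_mul hδ0.le, ← ofReal_measureReal, ← ENNReal.ofReal_mul ht.le,
      ENNReal.ofReal_le_ofReal_iff
        (mul_nonneg hδ0.le (integral_nonneg fun x => hu0 x))] at key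
    rw [integral_sub (hui.integrableOn.const_mul δ) (integrable_const _), integral_const_mul,
      setIntegral_const, smul_eq_mul]
    linarith
  have hmain := lintegral_rpow_neg_le_of_sublevel hum hu0 hule hm0 hδ hq hX
    (by rw [hμL, hXdef]; field_simp) hsub
  set K := (δ * X) ^ (-(1 / (q - 1))) * ((q - 1) / (q - δ)) with hK
  have hK0 : 0 < K := by positivity
  have hexp : 1 - q / (q - 1) = -(1 / (q - 1)) := by
    field_simp
    ring
  have havg' : avgE (fun t => w t ^ (1 - q / (q - 1))) a b ≤ ENNReal.ofReal K := by
    rw [avgE, ENNReal.div_le_iff (by simpa using hab) ENNReal.ofReal_ne_top,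
      ← ENNReal.ofReal_mul hK0.le, ← hμL, hexp]
    refine le_trans (le_of_eq (lintegral_congr_ae ?_)) hmain
    filter_upwards [hwu] with x hx
    rw [hx]
  calc avgE w a b * (avgE (fun t => w t ^ (1 - q / (q - 1))) a b) ^ (q - 1)
      ≤ ENNReal.ofReal X * ENNReal.ofReal K ^ (q - 1) := by
        rw [havg]
        gcongr
    _ = ENNReal.ofReal ((1 / δ) * ((q - 1) / (q - δ)) ^ (q - 1)) := by
        rw [ENNReal.ofReal_rpow_of_pos hK0, ← ENNReal.ofReal_mul hX.le, hK,
          Real.mul_rpow (by positivity) (by positivity), ← Real.rpow_mul (by positivity),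
          neg_mul, one_div_mul_cancel hq1.ne', Real.rpow_neg_one]
        congr 1
        field_simp

theorem statement4 (δ q : ℝ) (hδ : 1 ≤ δ) (hq : δ < q) :
    (∀ A B : ℝ, A < B → ∀ w : ℝ → ℝ≥0∞, MemRHinf δ A B w →
      ∀ a b, A ≤ a → a < b → b ≤ B →
        avgE w a b * (avgE (fun t => w t ^ (1 - q / (q - 1))) a b) ^ (q - 1)
          ≤ ENNReal.ofReal ((1 / δ) * ((q - 1) / (q - δ)) ^ (q - 1))) ∧
    (∀ C : ℝ, C < (1 / δ) * ((q - 1) / (q - δ)) ^ (q - 1) →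
      ∃ w : ℝ → ℝ≥0∞, MemRHinf δ 0 1 w ∧ ∃ a b : ℝ, 0 ≤ a ∧ a < b ∧ b ≤ 1 ∧
        ENNReal.ofReal C
          < avgE w a b * (avgE (fun t => w t ^ (1 - q / (q - 1))) a b) ^ (q - 1)) := by
  refine ⟨fun A B _ w hw a b hAa hab hbB => hw.avgE_mul_avgE_rpow_le hδ hq hAa hab hbB,
    fun C hC => ⟨_, memRHinf_rpow hδ, 0, 1, le_rfl, one_pos, le_rfl, ?_⟩⟩
  have hq1 : 0 < q - 1 := by linarith
  have hqδ : 0 < q - δ := by linarith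
  have hδ0 : 0 < δ := by linarith
  rw [avgE_rpow_mul_avgE_rpow hδ hq]
  exact (ENNReal.ofReal_lt_ofReal_iff (by positivity)).2 hC
end

section
/- Let δ ≥ 1. Then every weight w ∈ RH_∞^δ(I) on a bounded interval I ⊂ ℝ satisfies, for every subinterval J ⊂ I, ⟨w⟩_J · exp(−⟨log w⟩_J) ≤ (1/δ) · exp(δ − 1), and this constant is the best possible. -/
open MeasureTheory Set ENNReal

/-- The average `⟨f⟩_{(a,b)}` of a real-valued function over an interval. -/
noncomputable def avgR (f : ℝ → ℝ) (a b : ℝ) : ℝ :=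
  (∫ t in Set.Ioo a b, f t) / (b - a)

/-- `w ∈ RH_∞^δ([A,B])`: a nonnegative measurable integrable weight with
`ess sup_J w ≤ δ ⟨w⟩_J` on every subinterval `J`. -/
def MemRHinfReal (δ A B : ℝ) (w : ℝ → ℝ) : Prop :=
  Measurable w ∧ (∀ t, 0 ≤ w t) ∧ IntegrableOn w (Set.Ioo A B) ∧
    ∀ a b, A ≤ a → a < b → b ≤ B →
      essSup (fun t => ENNReal.ofReal (w t)) (volume.restrict (Set.Ioo a b))
        ≤ ENNReal.ofReal (δ * avgR w a b)

open Filter Topology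

/-- The order-connected components of a bounded open set of reals are open intervals whose
endpoints lie outside the set. -/
lemma exists_ordConnectedComponent_eq_Ioo {U : Set ℝ} (hU : IsOpen U) {a b : ℝ}
    (hab : U ⊆ Ioo a b) {x : ℝ} (hx : x ∈ U) :
    ∃ c d, c < d ∧ c ∉ U ∧ d ∉ U ∧ ordConnectedComponent U x = Ioo c d := by
  set C := ordConnectedComponent U x with hC
  have hCU : C ⊆ U := ordConnectedComponent_subset
  have hxC : x ∈ C := self_mem_ordConnectedComponent.2 hx
  have hbb : BddBelow C := ⟨a, fun y hy => (hab (hCU hy)).1.le⟩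
  have hba : BddAbove C := ⟨b, fun y hy => (hab (hCU hy)).2.le⟩
  have hoc : OrdConnected C := inferInstance
  have hsub : Ioo (sInf C) (sSup C) ⊆ C := by
    intro y hy
    obtain ⟨z, hz, hzy⟩ := exists_lt_of_csInf_lt ⟨x, hxC⟩ hy.1
    obtain ⟨z', hz', hyz⟩ := exists_lt_of_lt_csSup ⟨x, hxC⟩ hy.2
    exact hoc.out hz hz' ⟨hzy.le, hyz.le⟩
  have hmem : ∀ y, y ∈ U → (y ∈ C ↔ C ∈ 𝓝 y) := by
    intro y hyU
    refine ⟨fun hy => ?_, mem_of_mem_nhds⟩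
    rw [hC, ordConnectedComponent_eq (mem_ordConnectedComponent.1 hy)]
    exact ordConnectedComponent_mem_nhds.2 (hU.mem_nhds hyU)
  have hc : sInf C ∉ C := by
    intro h
    have h1 := (hmem _ (hCU h)).1 h
    obtain ⟨l, hl, hl'⟩ := exists_Ioc_subset_of_mem_nhds h1 ⟨sInf C - 1, by linarith⟩
    have h2 := csInf_le hbb (hl' ⟨show l < (l + sInf C) / 2 by linarith, by linarith⟩)
    linarith
  have hd : sSup C ∉ C := by
    intro h
    have h1 := (hmem _ (hCU h)).1 h
    obtain ⟨l, hl, hl'⟩ := exists_Ico_subset_of_mem_nhds h1 ⟨sSup C + 1, by linarith⟩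
    have h2 := le_csSup hba (hl' ⟨by linarith, show (l + sSup C) / 2 < l by linarith⟩)
    linarith
  have hcx : sInf C < x := lt_of_le_of_ne (csInf_le hbb hxC) (fun h => hc (h ▸ hxC))
  have hxd : x < sSup C := lt_of_le_of_ne (le_csSup hba hxC) (fun h => hd (h ▸ hxC))
  refine ⟨sInf C, sSup C, hcx.trans hxd, fun h => hc ?_, fun h => hd ?_, ?_⟩
  · rw [hC, mem_ordConnectedComponent, uIcc_of_ge hcx.le]
    intro y hy
    rcases eq_or_lt_of_le hy.1 with h1 | h1
    · exact h1 ▸ h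
    · exact hCU (hsub ⟨h1, hy.2.trans_lt hxd⟩)
  · rw [hC, mem_ordConnectedComponent, uIcc_of_le hxd.le]
    intro y hy
    rcases eq_or_lt_of_le hy.2 with h1 | h1
    · exact h1 ▸ h
    · exact hCU (hsub ⟨hcx.trans_le hy.1, h1⟩)
  · refine Subset.antisymm (fun y hy => ⟨?_, ?_⟩) hsub
    · exact lt_of_le_of_ne (csInf_le hbb hy) (fun h => hc (h ▸ hy))
    · exact lt_of_le_of_ne (le_csSup hba hy) (fun h => hd (h ▸ hy))

/-- To compare two measures on a bounded open set of reals, it suffices to compare them on its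
connected components. -/
lemma measure_le_of_forall_Ioo_component {μ ν : Measure ℝ} {U : Set ℝ} (hU : IsOpen U) {a b : ℝ}
    (hab : U ⊆ Ioo a b)
    (h : ∀ c d, c < d → c ∉ U → d ∉ U → Ioo c d ⊆ U → μ (Ioo c d) ≤ ν (Ioo c d)) :
    μ U ≤ ν U := by
  set S : Set (Set ℝ) := ordConnectedComponent U '' U with hS
  have hIoo : ∀ C ∈ S, ∃ c d, c < d ∧ c ∉ U ∧ d ∉ U ∧ C = Ioo c d := by
    rintro _ ⟨x, hx, rfl⟩
    exact exists_ordConnectedComponent_eq_Ioo hU hab hx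
  have hsub : ∀ C ∈ S, C ⊆ U := by
    rintro _ ⟨x, hx, rfl⟩
    exact ordConnectedComponent_subset
  have hopen : ∀ C ∈ S, IsOpen C := by
    intro C hC
    obtain ⟨c, d, -, -, -, rfl⟩ := hIoo C hC
    exact isOpen_Ioo
  have hdisj : S.PairwiseDisjoint id := by
    rintro _ ⟨x, hx, rfl⟩ _ ⟨y, hy, rfl⟩ hne
    refine Set.disjoint_left.2 fun z hzx hzy => hne ?_
    rw [ordConnectedComponent_eq (mem_ordConnectedComponent.1 hzx),
      ordConnectedComponent_eq (mem_ordConnectedComponent.1 hzy)]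
  have hcount : S.Countable := by
    refine hdisj.countable_of_isOpen hopen ?_
    rintro _ ⟨x, hx, rfl⟩
    exact ⟨x, self_mem_ordConnectedComponent.2 hx⟩
  have hUS : U = ⋃ C ∈ S, id C := by
    refine Subset.antisymm (fun x hx => ?_) (iUnion₂_subset hsub)
    exact mem_biUnion (mem_image_of_mem _ hx) (self_mem_ordConnectedComponent.2 hx)
  rw [hUS, measure_biUnion hcount hdisj fun C hC => (hopen C hC).measurableSet,
    measure_biUnion hcount hdisj fun C hC => (hopen C hC).measurableSet]
  refine ENNReal.tsum_le_tsum fun ⟨C, hC⟩ => ?_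
  obtain ⟨c, d, hcd, hc, hd, rfl⟩ := hIoo C hC
  exact h c d hcd hc hd (hsub _ hC)

/-- Almost every point of a set of reals is a point of accumulation in measure from both sides. -/
lemma ae_restrict_measure_inter_Ioo_ne_zero (E : Set ℝ) :
    ∀ᵐ x ∂volume.restrict E, ∀ y,
      (x < y → volume (E ∩ Ioo x y) ≠ 0) ∧ (y < x → volume (E ∩ Ioo y x) ≠ 0) := by
  filter_upwards [IsUnifLocDoublingMeasure.ae_tendsto_measure_inter_div volume E 1] with x hx y
  have key : ∀ s : ℝ, (s = 1 ∨ s = -1) → ∀ u > 0, ∃ r, 0 < r ∧ r < u ∧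
      volume (E ∩ Icc (x + s * r - r) (x + s * r + r)) ≠ 0 := by
    intro s hs u hu
    have h1 := hx (fun r : ℝ => x + s * r) id tendsto_id (l := 𝓝[>] (0 : ℝ)) (by
      filter_upwards [self_mem_nhdsWithin] with r hr
      have hr : 0 < r := hr
      rcases hs with rfl | rfl <;> simp [abs_of_pos hr])
    have h2 := h1.eventually (lt_mem_nhds (show (0 : ℝ≥0∞) < 1 by simp))
    obtain ⟨r, ⟨hr, hr0⟩, hru⟩ :=
      ((h2.and self_mem_nhdsWithin).and (mem_nhdsWithin_of_mem_nhds (Iio_mem_nhds hu))).exists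
    refine ⟨r, hr0, hru, fun h => ?_⟩
    rw [id, Real.closedBall_eq_Icc, h] at hr
    simp at hr
  refine ⟨fun hy => ?_, fun hy => ?_⟩
  · obtain ⟨r, hr, hru, hne⟩ := key 1 (Or.inl rfl) ((y - x) / 2) (by linarith)
    contrapose! hne
    refine measure_mono_null (t := E ∩ Ioo x y ∪ {x}) (fun z hz => ?_)
      (measure_union_null hne (by simp))
    rcases eq_or_ne z x with rfl | h
    · simp
    · have := lt_of_le_of_ne (show x ≤ z by linarith [hz.2.1]) h.symm
      exact Or.inl ⟨hz.1, this, by linarith [hz.2.2]⟩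
  · obtain ⟨r, hr, hru, hne⟩ := key (-1) (Or.inr rfl) ((x - y) / 2) (by linarith)
    contrapose! hne
    refine measure_mono_null (t := E ∩ Ioo y x ∪ {x}) (fun z hz => ?_)
      (measure_union_null hne (by simp))
    rcases eq_or_ne z x with rfl | h
    · simp
    · have := lt_of_le_of_ne (show z ≤ x by linarith [hz.2.2]) h
      exact Or.inl ⟨hz.1, by linarith [hz.2.1], this⟩

/-- Sublevel sets of an `RH_∞^δ` weight: the average over `{w < l}` is at least `l / δ`. -/
lemma ofReal_mul_measure_sublevel_le {δ a b : ℝ} (hδ : 0 < δ) {w : ℝ → ℝ}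
    (hw : Measurable w) (hw0 : ∀ t, 0 ≤ w t) (hwint : IntegrableOn w (Ioo a b))
    (h : ∀ c d, a ≤ c → c < d → d ≤ b →
      ∀ᵐ t ∂volume.restrict (Ioo c d), w t ≤ δ * avgR w c d)
    {l : ℝ} (hl : l ≤ δ * avgR w a b) :
    ENNReal.ofReal (l / δ) * volume (Ioo a b ∩ {t | w t < l})
      ≤ ∫⁻ t in Ioo a b ∩ {t | w t < l}, ENNReal.ofReal (w t) := by
  set E : Set ℝ := Ioo a b ∩ {t | l ≤ w t} with hE
  set S : Set ℝ := Ioo a b ∩ {t | w t < l} with hS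
  have hEm : MeasurableSet E := measurableSet_Ioo.inter (measurableSet_le measurable_const hw)
  obtain ⟨N, hNs, hNm, hN⟩ :=
    exists_measurable_superset_of_null
      ((ae_restrict_iff' hEm).1 (ae_restrict_measure_inter_Ioo_ne_zero E))
  have hfin : ∫⁻ t in Ioo a b, ENNReal.ofReal (w t) ≠ ∞ := hwint.lintegral_lt_top.ne
  set ν : Measure ℝ := volume.withDensity fun t => ENNReal.ofReal (w t) with hν
  have hνE : ∀ s, MeasurableSet s → ν s = ∫⁻ t in s, ENNReal.ofReal (w t) :=
    fun s hs => withDensity_apply _ hs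
  have hSm : MeasurableSet S := measurableSet_Ioo.inter (measurableSet_lt hw measurable_const)
  rw [← hνE S hSm]
  refine ENNReal.le_of_forall_pos_le_add fun ε hε _ => ?_
  obtain ⟨η, hη, hηε⟩ := exists_pos_setLIntegral_lt_of_measure_lt hfin
    (ε := (ε : ℝ≥0∞)) (by simpa using hε.ne')
  have hEN : volume (E \ N) ≠ ∞ := by
    refine ne_top_of_le_ne_top ?_ (measure_mono (sdiff_subset.trans inter_subset_left))
    simp
  obtain ⟨K, hKE, hKc, hKη⟩ := (hEm.diff hNm).exists_isClosed_sdiff_lt hEN hη.ne'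
  set U : Set ℝ := Ioo a b \ K with hU
  have hUo : IsOpen U := isOpen_Ioo.sdiff hKc
  have hcomp : (ENNReal.ofReal (l / δ) • (volume : Measure ℝ)) U ≤ ν U := by
    refine measure_le_of_forall_Ioo_component hUo sdiff_subset fun c d hcd hc hd hsub => ?_
    have hcd' : Icc c d ⊆ Icc a b := by
      rw [← closure_Ioo hcd.ne]
      exact closure_minimal ((hsub.trans sdiff_subset).trans Ioo_subset_Icc_self) isClosed_Icc
    have hac : a ≤ c := (hcd' (left_mem_Icc.2 hcd.le)).1
    have hdb : d ≤ b := (hcd' (right_mem_Icc.2 hcd.le)).2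
    have hpos : volume (E ∩ Ioo c d) ≠ 0 → l ≤ δ * avgR w c d := by
      intro hne
      by_contra! hlt
      refine hne (measure_mono_null (fun t ht => ?_)
        ((ae_restrict_iff' measurableSet_Ioo).1 (h c d hac hcd hdb)))
      intro h'
      exact absurd (h' ht.2) (not_le.2 (hlt.trans_le ht.1.2))
    have hKd : ∀ x ∈ K, ∀ y,
        (x < y → volume (E ∩ Ioo x y) ≠ 0) ∧ (y < x → volume (E ∩ Ioo y x) ≠ 0) := by
      intro x hx
      by_contra hcon
      exact (hKE hx).2 (hNs fun h' => hcon (h' (hKE hx).1))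
    have hle : l ≤ δ * avgR w c d := by
      rcases eq_or_lt_of_le hac with hca | hca
      · rcases eq_or_lt_of_le hdb with hbd | hbd
        · rwa [← hca, hbd]
        · have hdK : d ∈ K := by
            by_contra hK
            exact hd ⟨⟨hac.trans_lt hcd, hbd⟩, hK⟩
          exact hpos ((hKd d hdK c).2 hcd)
      · have hcK : c ∈ K := by
          by_contra hK
          exact hc ⟨⟨hca, hcd.trans_le hdb⟩, hK⟩
        exact hpos ((hKd c hcK d).1 hcd)
    rw [hνE _ measurableSet_Ioo, Measure.smul_apply, Real.volume_Ioo, smul_eq_mul,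
      ← ENNReal.ofReal_mul' (by linarith), ← ofReal_integral_eq_lintegral_ofReal
        (hwint.mono_set (Ioo_subset_Ioo hac hdb)) (ae_of_all _ hw0)]
    refine ENNReal.ofReal_le_ofReal ?_
    have hdc : 0 < d - c := by linarith
    have : l / δ ≤ avgR w c d := by rw [div_le_iff₀ hδ]; linarith
    rwa [avgR, le_div_iff₀ hdc] at this
  calc ENNReal.ofReal (l / δ) * volume S ≤ ENNReal.ofReal (l / δ) * volume U := by
        gcongr
        intro t ht
        exact ⟨ht.1, fun hK => (not_le.2 (show w t < l from ht.2)) (hKE hK).1.2⟩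
    _ ≤ ν U := hcomp
    _ ≤ ν (S ∪ ((E \ N) \ K ∪ N)) := by
        refine measure_mono fun t ht => ?_
        by_cases h1 : w t < l
        · exact Or.inl ⟨ht.1, h1⟩
        · by_cases h2 : t ∈ N
          · exact Or.inr (Or.inr h2)
          · exact Or.inr (Or.inl ⟨⟨⟨ht.1, not_lt.1 h1⟩, h2⟩, ht.2⟩)
    _ ≤ ν S + (ν ((E \ N) \ K) + ν N) :=
        (measure_union_le _ _).trans (by gcongr; exact measure_union_le _ _)
    _ ≤ ν S + ε := by
        have hνN : ν N = 0 := withDensity_absolutelyContinuous _ _ hN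
        rw [hνN, add_zero]
        gcongr
        have hm : MeasurableSet ((E \ N) \ K) := (hEm.diff hNm).diff hKc.measurableSet
        have := hηε ((E \ N) \ K) ((Measure.restrict_apply_le _ _).trans_lt hKη)
        rw [hνE _ hm]
        rw [Measure.restrict_restrict hm, inter_eq_left.2
          ((sdiff_subset.trans sdiff_subset).trans inter_subset_left)] at this
        exact this.le

lemma setLIntegral_Ioc_ofReal_inv {u M : ℝ} (hu : 0 < u) (huM : u ≤ M) :
    ∫⁻ l in Ioc u M, ENNReal.ofReal l⁻¹ = ENNReal.ofReal (Real.log M - Real.log u) := by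
  have hi : IntervalIntegrable (fun l : ℝ => l⁻¹) volume u M :=
    intervalIntegral.intervalIntegrable_inv (fun x hx => by
      rw [uIcc_of_le huM] at hx; linarith [hx.1]) continuousOn_id
  rw [← ofReal_integral_eq_lintegral_ofReal
      ((intervalIntegrable_iff_integrableOn_Ioc_of_le huM).1 hi)
      ((ae_restrict_mem measurableSet_Ioc).mono fun l hl => inv_nonneg.2 (hu.trans hl.1).le),
    ← intervalIntegral.integral_of_le huM, integral_inv_of_pos hu (hu.trans_le huM),
    Real.log_div (hu.trans_le huM).ne' hu.ne']

lemma setLIntegral_Ioc_zero_ofReal_inv {M : ℝ} (hM : 0 < M) :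
    ∫⁻ l in Ioc 0 M, ENNReal.ofReal l⁻¹ = ∞ := by
  by_contra hne
  have hi : IntegrableOn (fun l : ℝ => l⁻¹) (Ioc 0 M) := by
    refine ⟨by fun_prop, ?_⟩
    rw [hasFiniteIntegral_iff_ofReal
      ((ae_restrict_mem measurableSet_Ioc).mono fun l hl => inv_nonneg.2 hl.1.le)]
    exact lt_top_iff_ne_top.2 hne
  have := (intervalIntegrable_iff_integrableOn_Ioc_of_le hM.le).2 hi
  rw [intervalIntegrable_inv_iff] at this
  rcases this with h | h
  · exact hM.ne h
  · exact h left_mem_uIcc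

lemma setLIntegral_Ioc_ofReal_inv_sq {u M : ℝ} (hu : 0 < u) (huM : u ≤ M) :
    ∫⁻ l in Ioc u M, ENNReal.ofReal (l ^ 2)⁻¹ = ENNReal.ofReal (u⁻¹ - M⁻¹) := by
  have hpos : ∀ x ∈ uIcc u M, x ≠ 0 := fun x hx => by
    rw [uIcc_of_le huM] at hx; linarith [hx.1]
  have hi : IntervalIntegrable (fun l : ℝ => (l ^ 2)⁻¹) volume u M :=
    intervalIntegral.intervalIntegrable_inv (fun x hx => pow_ne_zero 2 (hpos x hx))
      (continuousOn_id.pow 2)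
  have hd : ∀ x ∈ uIcc u M, HasDerivAt (fun l : ℝ => -l⁻¹) (x ^ 2)⁻¹ x := fun x hx => by
    have := (hasDerivAt_inv (hpos x hx)).neg
    rwa [neg_neg] at this
  rw [← ofReal_integral_eq_lintegral_ofReal
      ((intervalIntegrable_iff_integrableOn_Ioc_of_le huM).1 hi)
      (ae_of_all _ fun l => by positivity),
    ← intervalIntegral.integral_of_le huM,
    intervalIntegral.integral_eq_sub_of_hasDerivAt hd hi]
  congr 1; ring

lemma ofReal_mul_setLIntegral_Ioc_le {u M : ℝ} (hu : 0 ≤ u) (huM : u ≤ M) :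
    ENNReal.ofReal u * ∫⁻ l in Ioc u M, ENNReal.ofReal (l ^ 2)⁻¹
      ≤ ENNReal.ofReal (1 - u / M) := by
  rcases eq_or_lt_of_le hu with rfl | hu
  · simp
  · rw [setLIntegral_Ioc_ofReal_inv_sq hu huM, ← ENNReal.ofReal_mul hu.le]
    refine ENNReal.ofReal_le_ofReal (le_of_eq ?_)
    field_simp

/-- If the average over every sublevel set `{w < l}`, `l ≤ M`, is at least `l / δ`, then `log w`
is integrable, with an explicit bound. -/
lemma integrable_log_and_integral_le {α : Type*} [MeasurableSpace α] {μ : Measure α}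
    [IsFiniteMeasure μ] {δ M : ℝ} (hδ : 0 < δ) (hM : 0 < M) {w : α → ℝ} (hw : Measurable w)
    (hw0 : ∀ t, 0 ≤ w t) (hwint : Integrable w μ) (hwM : ∀ᵐ t ∂μ, w t ≤ M)
    (h : ∀ l, 0 < l → l ≤ M → ENNReal.ofReal (l / δ) * μ {t | w t < l}
      ≤ ∫⁻ t in {t | w t < l}, ENNReal.ofReal (w t) ∂μ) :
    Integrable (fun t => Real.log (w t)) μ ∧
      ∫ t, (Real.log M - Real.log (w t)) ∂μ ≤ δ * ∫ t, (1 - w t / M) ∂μ := by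
  set F : α → ℝ → ℝ≥0∞ := fun t l => {p : α × ℝ | w p.1 < p.2}.indicator
    (fun p => ENNReal.ofReal p.2⁻¹) (t, l) with hF
  set G : α → ℝ → ℝ≥0∞ := fun t l => {p : α × ℝ | w p.1 < p.2}.indicator
    (fun p => ENNReal.ofReal (p.2 ^ 2)⁻¹ * ENNReal.ofReal (w p.1)) (t, l) with hG
  have hm : MeasurableSet {p : α × ℝ | w p.1 < p.2} :=
    measurableSet_lt (hw.comp measurable_fst) measurable_snd
  have hFm : Measurable (Function.uncurry F) :=
    (by fun_prop : Measurable fun p : α × ℝ => ENNReal.ofReal p.2⁻¹).indicator hm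
  have hGm : Measurable (Function.uncurry G) :=
    (by fun_prop : Measurable fun p : α × ℝ =>
      ENNReal.ofReal (p.2 ^ 2)⁻¹ * ENNReal.ofReal (w p.1)).indicator hm
  have hml : ∀ l, MeasurableSet {t | w t < l} := fun l => measurableSet_lt hw measurable_const
  have hlevel : ∀ l ∈ Ioc 0 M, ∫⁻ t, F t l ∂μ ≤ ENNReal.ofReal δ * ∫⁻ t, G t l ∂μ := by
    intro l hl
    have hF' : ∫⁻ t, F t l ∂μ = ENNReal.ofReal l⁻¹ * μ {t | w t < l} := by
      rw [← lintegral_indicator_const (hml l)]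
      rfl
    have hG' : ∫⁻ t, G t l ∂μ
        = ENNReal.ofReal (l ^ 2)⁻¹ * ∫⁻ t in {t | w t < l}, ENNReal.ofReal (w t) ∂μ := by
      rw [← lintegral_const_mul _ (by fun_prop), ← lintegral_indicator (hml l)]
      rfl
    rw [hF', hG']
    have h1 : ENNReal.ofReal l⁻¹ = ENNReal.ofReal (δ * (l ^ 2)⁻¹) * ENNReal.ofReal (l / δ) := by
      rw [← ENNReal.ofReal_mul (by positivity)]
      have := hl.1.ne'
      congr 1
      field_simp
    rw [h1, mul_assoc, ENNReal.ofReal_mul hδ.le, mul_assoc]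
    gcongr
    exact h l hl.1 hl.2
  have hFin : ∀ t, ∫⁻ l in Ioc 0 M, F t l = ∫⁻ l in Ioc (w t) M, ENNReal.ofReal l⁻¹ := by
    intro t
    have : ∀ l, F t l = (Ioi (w t)).indicator (fun l => ENNReal.ofReal l⁻¹) l := fun l => rfl
    simp_rw [this]
    rw [lintegral_indicator measurableSet_Ioi, Measure.restrict_restrict measurableSet_Ioi]
    congr 2
    ext l
    simp only [mem_inter_iff, mem_Ioi, mem_Ioc]
    have := hw0 t
    exact ⟨fun h => ⟨h.1, h.2.2⟩, fun h => ⟨h.1, this.trans_lt h.1, h.2⟩⟩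
  have hGin : ∀ t, ∫⁻ l in Ioc 0 M, G t l
      = ENNReal.ofReal (w t) * ∫⁻ l in Ioc (w t) M, ENNReal.ofReal (l ^ 2)⁻¹ := by
    intro t
    have : ∀ l, G t l = (Ioi (w t)).indicator
      (fun l => ENNReal.ofReal (l ^ 2)⁻¹ * ENNReal.ofReal (w t)) l := fun l => rfl
    simp_rw [this]
    rw [lintegral_indicator measurableSet_Ioi, Measure.restrict_restrict measurableSet_Ioi,
      lintegral_mul_const _ (by fun_prop), mul_comm]
    congr 3
    ext l
    simp only [mem_inter_iff, mem_Ioi, mem_Ioc]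
    have := hw0 t
    exact ⟨fun h => ⟨h.1, h.2.2⟩, fun h => ⟨h.1, this.trans_lt h.1, h.2⟩⟩
  have hwint' : Integrable (fun t => 1 - w t / M) μ := (integrable_const 1).sub (hwint.div_const M)
  have hnn : 0 ≤ᵐ[μ] fun t => 1 - w t / M := by
    filter_upwards [hwM] with t ht
    have : w t / M ≤ 1 := (div_le_one hM).2 ht
    simpa using this
  have hmain : ∫⁻ t, (∫⁻ l in Ioc 0 M, F t l) ∂μ ≤ ENNReal.ofReal (δ * ∫ t, (1 - w t / M) ∂μ) := by
    calc ∫⁻ t, (∫⁻ l in Ioc 0 M, F t l) ∂μ = ∫⁻ l in Ioc 0 M, ∫⁻ t, F t l ∂μ :=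
          lintegral_lintegral_swap hFm.aemeasurable
      _ ≤ ∫⁻ l in Ioc 0 M, ENNReal.ofReal δ * ∫⁻ t, G t l ∂μ :=
          setLIntegral_mono' measurableSet_Ioc hlevel
      _ = ENNReal.ofReal δ * ∫⁻ l in Ioc 0 M, ∫⁻ t, G t l ∂μ :=
          lintegral_const_mul _ hGm.lintegral_prod_left
      _ = ENNReal.ofReal δ * ∫⁻ t, (∫⁻ l in Ioc 0 M, G t l) ∂μ := by
          rw [lintegral_lintegral_swap hGm.aemeasurable]
      _ ≤ ENNReal.ofReal δ * ∫⁻ t, ENNReal.ofReal (1 - w t / M) ∂μ := by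
          gcongr 1
          refine lintegral_mono_ae ?_
          filter_upwards [hwM] with t ht
          rw [hGin]
          exact ofReal_mul_setLIntegral_Ioc_le (hw0 t) ht
      _ = ENNReal.ofReal (δ * ∫ t, (1 - w t / M) ∂μ) := by
          rw [← ofReal_integral_eq_lintegral_ofReal hwint' hnn, ENNReal.ofReal_mul hδ.le]
  have hpos : ∀ᵐ t ∂μ, 0 < w t := by
    filter_upwards [ae_lt_top (hFm.lintegral_prod_right (ν := volume.restrict (Ioc 0 M)))
      (hmain.trans_lt ofReal_lt_top).ne] with t ht
    refine lt_of_le_of_ne (hw0 t) fun h0 => ht.ne ?_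
    have h1 := hFin t
    rw [← h0, setLIntegral_Ioc_zero_ofReal_inv hM] at h1
    exact h1
  have hlog : ∫⁻ t, ENNReal.ofReal (Real.log M - Real.log (w t)) ∂μ
      ≤ ENNReal.ofReal (δ * ∫ t, (1 - w t / M) ∂μ) := by
    refine le_of_eq_of_le (lintegral_congr_ae ?_) hmain
    filter_upwards [hpos, hwM] with t ht htM
    rw [hFin, setLIntegral_Ioc_ofReal_inv ht htM]
  have hnn' : 0 ≤ᵐ[μ] fun t => Real.log M - Real.log (w t) := by
    filter_upwards [hpos, hwM] with t ht htM
    exact sub_nonneg.2 (Real.log_le_log ht htM)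
  have hmeas : AEStronglyMeasurable (fun t => Real.log M - Real.log (w t)) μ :=
    ((Real.measurable_log.comp hw).const_sub _).aestronglyMeasurable
  have hi : Integrable (fun t => Real.log M - Real.log (w t)) μ :=
    ⟨hmeas, (hasFiniteIntegral_iff_ofReal hnn').2 (hlog.trans_lt ofReal_lt_top)⟩
  refine ⟨?_, ?_⟩
  · refine ((integrable_const (Real.log M)).sub hi).congr (ae_of_all _ fun t => ?_)
    simp
  · rw [integral_eq_lintegral_of_nonneg_ae hnn' hmeas]
    exact toReal_le_of_le_ofReal (mul_nonneg hδ.le (integral_nonneg_of_ae hnn)) hlog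

lemma setIntegral_Ioo_abs_rpow {δ a b : ℝ} (hδ : 1 ≤ δ) (ha : 0 ≤ a) (hab : a ≤ b) :
    ∫ t in Ioo a b, |t| ^ (δ - 1) = (b ^ δ - a ^ δ) / δ := by
  have h : ∫ t in Ioo a b, |t| ^ (δ - 1) = ∫ t in Ioo a b, t ^ (δ - 1) :=
    setIntegral_congr_fun measurableSet_Ioo fun t ht => by
      simp only [abs_of_pos (ha.trans_lt ht.1)]
  rw [h, ← integral_Ioc_eq_integral_Ioo, ← intervalIntegral.integral_of_le hab,
    integral_rpow (Or.inl (by linarith)), sub_add_cancel]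

lemma memRHinfReal_abs_rpow {δ : ℝ} (hδ : 1 ≤ δ) :
    MemRHinfReal δ 0 1 fun t => |t| ^ (δ - 1) := by
  refine ⟨by fun_prop, fun t => by positivity, ?_, fun a b ha hab hb => ?_⟩
  · have hc : Continuous fun t : ℝ => |t| ^ (δ - 1) :=
      continuous_abs.rpow_const fun _ => Or.inr (by linarith)
    exact (hc.integrableOn_Icc (a := 0) (b := 1)).mono_set Ioo_subset_Icc_self
  · refine essSup_le_of_ae_le _ ?_
    filter_upwards [ae_restrict_mem measurableSet_Ioo] with t ht
    refine ENNReal.ofReal_le_ofReal ?_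
    have hb0 : 0 < b := ha.trans_lt hab
    have h1 : |t| ^ (δ - 1) ≤ b ^ (δ - 1) := by
      rw [abs_of_pos (ha.trans_lt ht.1)]
      exact Real.rpow_le_rpow (ha.trans ht.1.le) ht.2.le (by linarith)
    refine h1.trans ?_
    rw [avgR, setIntegral_Ioo_abs_rpow hδ ha hab.le]
    have h2 : ∀ x : ℝ, 0 ≤ x → x ^ δ = x ^ (δ - 1) * x := fun x hx => by
      rw [← Real.rpow_add_one' hx (by linarith), sub_add_cancel]
    have h3 : a ^ (δ - 1) ≤ b ^ (δ - 1) := Real.rpow_le_rpow ha hab.le (by linarith)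
    rw [h2 a ha, h2 b hb0.le]
    have hδ0 : δ ≠ 0 := by linarith
    have h4 : δ * ((b ^ (δ - 1) * b - a ^ (δ - 1) * a) / δ / (b - a))
        = (b ^ (δ - 1) * b - a ^ (δ - 1) * a) / (b - a) := by
      field_simp
    rw [h4, le_div_iff₀ (by linarith)]
    nlinarith

lemma integrableOn_log_abs_rpow (δ : ℝ) :
    IntegrableOn (fun t : ℝ => Real.log (|t| ^ (δ - 1))) (Ioo 0 1) ∧
      avgR (fun t : ℝ => Real.log (|t| ^ (δ - 1))) 0 1 = -(δ - 1) := by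
  have h : EqOn (fun t : ℝ => Real.log (|t| ^ (δ - 1))) (fun t => (δ - 1) * Real.log t)
      (Ioo 0 1) := fun t ht => by
    simp only [abs_of_pos ht.1, Real.log_rpow ht.1]
  constructor
  · refine (IntegrableOn.congr_fun ?_ h.symm measurableSet_Ioo)
    have : IntervalIntegrable Real.log volume 0 1 := intervalIntegral.intervalIntegrable_log'
    have h2 := (intervalIntegrable_iff_integrableOn_Ioo_of_le zero_le_one).1 this
    exact h2.const_mul _
  · rw [avgR, setIntegral_congr_fun measurableSet_Ioo h, ← integral_Ioc_eq_integral_Ioo,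
      ← intervalIntegral.integral_of_le zero_le_one, intervalIntegral.integral_const_mul,
      integral_log]
    simp

lemma MemRHinfReal.ae_le {δ A B : ℝ} (hδ : 0 ≤ δ) {w : ℝ → ℝ} (h : MemRHinfReal δ A B w)
    {c d : ℝ} (hc : A ≤ c) (hcd : c < d) (hd : d ≤ B) :
    ∀ᵐ t ∂volume.restrict (Ioo c d), w t ≤ δ * avgR w c d := by
  have h0 : 0 ≤ δ * avgR w c d :=
    mul_nonneg hδ (div_nonneg (integral_nonneg h.2.1) (by linarith))
  filter_upwards [ENNReal.ae_le_essSup (μ := volume.restrict (Ioo c d))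
    fun t => ENNReal.ofReal (w t)] with t ht
  exact (ENNReal.ofReal_le_ofReal_iff h0).1 (ht.trans (h.2.2.2 c d hc hcd hd))

/-- The logarithm of an `RH_∞^δ` weight is integrable, and `⟨w⟩ exp(-⟨log w⟩) ≤ exp(δ - 1) / δ`. -/
lemma MemRHinfReal.integrableOn_log_and_avgR_mul_exp_le {δ A B : ℝ} (hδ : 1 ≤ δ) {w : ℝ → ℝ}
    (h : MemRHinfReal δ A B w) {a b : ℝ} (ha : A ≤ a) (hab : a < b) (hb : b ≤ B) :
    IntegrableOn (fun t => Real.log (w t)) (Ioo a b) ∧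
      avgR w a b * Real.exp (-(avgR (fun t => Real.log (w t)) a b))
        ≤ (1 / δ) * Real.exp (δ - 1) := by
  have hδ0 : 0 < δ := by linarith
  have hba : 0 < b - a := by linarith
  have hae : ∀ c d, a ≤ c → c < d → d ≤ b →
      ∀ᵐ t ∂volume.restrict (Ioo c d), w t ≤ δ * avgR w c d :=
    fun c d hc hcd hd => h.ae_le hδ0.le (ha.trans hc) hcd (hd.trans hb)
  obtain ⟨hw, hw0, hwint, -⟩ := h
  replace hwint : IntegrableOn w (Ioo a b) := hwint.mono_set (Ioo_subset_Ioo ha hb)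
  have hm : 0 ≤ avgR w a b := div_nonneg (integral_nonneg hw0) hba.le
  rcases eq_or_lt_of_le hm with hm | hm
  · rw [← hm, zero_mul]
    refine ⟨?_, by positivity⟩
    refine (integrable_zero ℝ ℝ _).congr ?_
    filter_upwards [hae a b le_rfl hab le_rfl] with t ht
    rw [← hm, mul_zero] at ht
    simp [le_antisymm ht (hw0 t)]
  have hM : 0 < δ * avgR w a b := mul_pos hδ0 hm
  obtain ⟨hi, hle⟩ := integrable_log_and_integral_le (μ := volume.restrict (Ioo a b)) hδ0 hM hw hw0
    hwint (hae a b le_rfl hab le_rfl) fun l _ hlM => by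
      have := ofReal_mul_measure_sublevel_le hδ0 hw hw0 hwint hae hlM
      have hml : MeasurableSet {t | w t < l} := measurableSet_lt hw measurable_const
      rwa [Measure.restrict_apply hml, Measure.restrict_restrict hml, inter_comm]
  refine ⟨hi, ?_⟩
  have hwi : ∫ t in Ioo a b, w t = avgR w a b * (b - a) := by
    rw [avgR, div_mul_cancel₀ _ hba.ne']
  have hli : ∫ t in Ioo a b, Real.log (w t)
      = avgR (fun t => Real.log (w t)) a b * (b - a) := by
    rw [avgR, div_mul_cancel₀ _ hba.ne']
  rw [integral_sub (integrable_const _) hi, integral_sub (integrable_const _) (hwint.div_const _),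
    integral_div, hwi, hli] at hle
  simp only [integral_const, measureReal_restrict_apply_univ, Real.volume_real_Ioo_of_le hab.le,
    smul_eq_mul, mul_one] at hle
  have hR : δ * (b - a - avgR w a b * (b - a) / (δ * avgR w a b)) = (δ - 1) * (b - a) := by
    field_simp
  rw [hR] at hle
  have hexp : -(avgR (fun t => Real.log (w t)) a b) ≤ δ - 1 - Real.log (δ * avgR w a b) := by
    nlinarith
  calc avgR w a b * Real.exp (-(avgR (fun t => Real.log (w t)) a b))
      ≤ avgR w a b * Real.exp (δ - 1 - Real.log (δ * avgR w a b)) := by gcongr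
    _ = (1 / δ) * Real.exp (δ - 1) := by
        rw [Real.exp_sub, Real.exp_log hM]
        field_simp

theorem statement5 (δ : ℝ) (hδ : 1 ≤ δ) :
    (∀ A B : ℝ, A < B → ∀ w : ℝ → ℝ, MemRHinfReal δ A B w →
      ∀ a b, A ≤ a → a < b → b ≤ B →
        IntegrableOn (fun t => Real.log (w t)) (Set.Ioo a b) ∧
        avgR w a b * Real.exp (-(avgR (fun t => Real.log (w t)) a b))
          ≤ (1 / δ) * Real.exp (δ - 1)) ∧
    (∀ C : ℝ, C < (1 / δ) * Real.exp (δ - 1) →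
      ∃ w : ℝ → ℝ, MemRHinfReal δ 0 1 w ∧ ∃ a b : ℝ, 0 ≤ a ∧ a < b ∧ b ≤ 1 ∧
        IntegrableOn (fun t => Real.log (w t)) (Set.Ioo a b) ∧
        C < avgR w a b * Real.exp (-(avgR (fun t => Real.log (w t)) a b))) := by
  refine ⟨fun A B _ w hw a b ha hab hb => hw.integrableOn_log_and_avgR_mul_exp_le hδ ha hab hb,
    fun C hC => ⟨fun t => |t| ^ (δ - 1), memRHinfReal_abs_rpow hδ, 0, 1, le_rfl, zero_lt_one,
      le_rfl, (integrableOn_log_abs_rpow δ).1, ?_⟩⟩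
  rw [(integrableOn_log_abs_rpow δ).2, neg_neg, avgR,
    setIntegral_Ioo_abs_rpow hδ le_rfl zero_le_one,
    Real.one_rpow, Real.zero_rpow (by linarith)]
  simpa using hC
end

section
/- Let n > 1 and let Q ⊂ ℝ^n be a cube with sides parallel to the coordinate axes. Fix p > 1, q > 1 and η > 1. Then there exists δ > 1 such that every weight w on Q satisfying ⟨w^p⟩_K ≤ δ^p ⟨w⟩_K^p for every axis-parallel subcube K ⊂ Q also satisfies ⟨w⟩_K · ⟨w^{1−q'}⟩_K^{q−1} ≤ η for every axis-parallel subcube K ⊂ Q. -/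
open MeasureTheory Set ENNReal

/-- The average of an `ℝ≥0∞`-valued function over the open axis-parallel cube
with corner `k` and side length `ℓ`. -/
noncomputable def cubeAvg {n : ℕ} (w : (Fin n → ℝ) → ℝ≥0∞) (k : Fin n → ℝ) (ℓ : ℝ) : ℝ≥0∞ :=
  (∫⁻ x in Set.pi Set.univ fun i => Set.Ioo (k i) (k i + ℓ), w x) /
    ENNReal.ofReal (ℓ ^ n)

/-- The cube with corner `k` and side `ℓ` is an axis-parallel subcube of the cube
with corner `c` and side `L`. -/
def SubCube {n : ℕ} (c : Fin n → ℝ) (L : ℝ) (k : Fin n → ℝ) (ℓ : ℝ) : Prop :=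
  0 < ℓ ∧ ∀ i, c i ≤ k i ∧ k i + ℓ ≤ c i + L

open Filter Topology

/-- Second order Taylor expansion of `(1 + t) ^ a` at `0`. -/
theorem Real.eventually_abs_one_add_rpow_sub_le (a : ℝ) {ε : ℝ} (hε : 0 < ε) :
    ∀ᶠ t in 𝓝 (0 : ℝ), |(1 + t) ^ a - (1 + a * t + a * (a - 1) / 2 * t ^ 2)| ≤ ε * t ^ 2 := by
  have hc : ContDiffOn ℝ (2 : ℕ) (fun x : ℝ => x ^ a) (Ioi 0) := fun x hx =>
    (Real.contDiffAt_rpow_const_of_ne (ne_of_gt hx)).contDiffWithinAt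
  have h := taylor_isLittleO (x₀ := (1 : ℝ)) (convex_Ioi 0) (by simp) hc
  rw [isOpen_Ioi.nhdsWithin_eq (by simp)] at h
  have h1 : iteratedDerivWithin 1 (fun x : ℝ => x ^ a) (Ioi 0) 1 = a := by
    rw [iteratedDerivWithin_of_isOpen isOpen_Ioi (by simp), iteratedDeriv_one]
    simp
  have h2 : iteratedDerivWithin 2 (fun x : ℝ => x ^ a) (Ioi 0) 1 = a * (a - 1) := by
    rw [iteratedDerivWithin_of_isOpen isOpen_Ioi (by simp), iteratedDeriv_eq_iterate,
      Real.iter_deriv_rpow_const]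
    simp [descPochhammer_succ_right]
  have h0 : Tendsto (fun t : ℝ => 1 + t) (𝓝 0) (𝓝 1) := by
    have : Continuous fun t : ℝ => 1 + t := by fun_prop
    simpa using this.tendsto 0
  filter_upwards [h0.eventually (h.def hε)] with t ht
  simp only [taylorWithinEval_succ, taylor_within_zero_eval, h1, h2, zero_add, Nat.cast_one,
    Nat.reduceAdd] at ht
  simp only [Real.norm_eq_abs, abs_pow, add_sub_cancel_left, sq_abs] at ht
  convert ht using 3
  simp
  ring

/-- The function `(1 + t) ^ p - 1 - p t` is bounded below by a positive constant away from `0`. -/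
theorem Real.exists_one_add_mul_add_le_rpow {p r : ℝ} (hp : 1 < p) (hr : 0 < r) (hr1 : r < 1) :
    ∃ κ > 0, ∀ t : ℝ, -1 ≤ t → r < |t| → 1 + p * t + κ ≤ (1 + t) ^ p := by
  have h1 := one_add_mul_self_lt_rpow_one_add (by linarith : -1 ≤ r) hr.ne' hp
  have h2 := one_add_mul_self_lt_rpow_one_add (by linarith : -1 ≤ -r) (by linarith) hp
  refine ⟨min ((1 + r) ^ p - (1 + p * r)) ((1 + -r) ^ p - (1 + p * -r)),
    lt_min (by linarith) (by linarith), fun t ht hrt => ?_⟩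
  have hb := one_add_mul_self_le_rpow_one_add ht hp.le
  have ht0 : 0 < |t| := hr.trans hrt
  have hl0 : 0 < r / |t| := by positivity
  have hl1 : r / |t| ≤ 1 := by rw [div_le_one ht0]; exact hrt.le
  have hconv := (convexOn_rpow hp.le).2 (x := 1) (y := 1 + t) (by simp) (by simp; linarith)
    (sub_nonneg.2 hl1) hl0.le (by ring)
  simp only [smul_eq_mul, Real.one_rpow, mul_one] at hconv
  have e : 1 - r / |t| + r / |t| * (1 + t) = 1 + r / |t| * t := by ring
  rw [e] at hconv
  have key : (1 + r / |t| * t) ^ p - (1 + p * (r / |t| * t)) ≤ (1 + t) ^ p - (1 + p * t) := by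
    nlinarith
  rcases abs_cases t with ⟨h, _⟩ | ⟨h, _⟩
  · have : r / |t| * t = r := by rw [h] at ht0 ⊢; field_simp
    rw [this] at key
    linarith [min_le_left ((1 + r) ^ p - (1 + p * r)) ((1 + -r) ^ p - (1 + p * -r))]
  · have : r / |t| * t = -r := by
      rw [h] at ht0 ⊢
      have : t ≠ 0 := by rintro rfl; simp at ht0
      field_simp
    rw [this] at key
    linarith [min_le_right ((1 + r) ^ p - (1 + p * r)) ((1 + -r) ^ p - (1 + p * -r))]

/-- A quadratic profile whose Bellman function `x ^ (-s) * φ (y / x ^ p - 1)` lies locally below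
its tangent planes. -/
theorem exists_bellman_profile {p s ε : ℝ} (hp : 1 < p) (hs : 0 < s) (hε : 0 < ε) :
    ∃ r > 0, r < 1 ∧ ∃ H > 0, ∃ (φ μ α : ℝ → ℝ),
      (∀ h ∈ Icc 0 H, 1 ≤ φ h ∧ φ h ≤ 1 + ε) ∧
      ∀ h₀ ∈ Icc 0 H, 0 ≤ μ h₀ ∧ ∀ t h : ℝ, |t| ≤ r → h ∈ Icc 0 H →
        (1 + t) ^ (-s) * φ h ≤
          φ h₀ + α h₀ * t + μ h₀ * ((1 + t) ^ p * (1 + h) - (1 + h₀)) := by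
  set c₀ := p * (p - 1) / 4 with hc₀
  have hc₀' : 0 < c₀ := by have := sub_pos.2 hp; positivity
  set C := s * (s + 1) with hC
  have hC' : 0 < C := by positivity
  set c := 2 * (2 * C + 1) / c₀ with hc
  have hc' : 0 < c := by positivity
  have hcc : c * c₀ = 2 * (2 * C + 1) := by rw [hc]; field_simp
  set M := c ^ 2 * (s + p) ^ 2 with hM
  have hM' : 0 < M := by positivity
  obtain ⟨r₀, hr₀, hr₀'⟩ := Metric.eventually_nhds_iff_ball.1
    ((Real.eventually_abs_one_add_rpow_sub_le p hc₀').and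
      (Real.eventually_abs_one_add_rpow_sub_le (-s) (half_pos hC')))
  set r := min (r₀ / 2) (min (1 / 2) (1 / (2 * s))) with hr
  have hrpos : 0 < r := by positivity
  have hr1 : r ≤ r₀ / 2 := min_le_left _ _
  have hr2 : r ≤ 1 / 2 := (min_le_right _ _).trans (min_le_left _ _)
  have hr3 : s * r ≤ 1 / 2 := by
    have : r ≤ 1 / (2 * s) := (min_le_right _ _).trans (min_le_right _ _)
    rw [le_div_iff₀ (by positivity)] at this
    linarith
  set H := min (c / (2 * M)) (min (1 / c) (ε / c)) with hH
  have hHpos : 0 < H := by positivity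
  have hH1 : M * H ≤ c / 2 := by
    have : H ≤ c / (2 * M) := min_le_left _ _
    rw [le_div_iff₀ (by positivity)] at this
    linarith
  have hH2 : c * H ≤ 1 := by
    have : H ≤ 1 / c := (min_le_right _ _).trans (min_le_left _ _)
    rw [le_div_iff₀ (by positivity)] at this
    linarith
  have hH3 : c * H ≤ ε := by
    have : H ≤ ε / c := (min_le_right _ _).trans (min_le_right _ _)
    rw [le_div_iff₀ (by positivity)] at this
    linarith
  have hφ : ∀ h ∈ Icc 0 H, 1 ≤ 1 + c * h - M / 2 * h ^ 2 ∧ 1 + c * h - M / 2 * h ^ 2 ≤ 1 + c * H := by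
    rintro h ⟨h0, h1⟩
    have : M * h ≤ c / 2 := (mul_le_mul_of_nonneg_left h1 hM'.le).trans hH1
    have : c * h ≤ c * H := mul_le_mul_of_nonneg_left h1 hc'.le
    constructor
    · nlinarith
    · nlinarith [sq_nonneg h]
  refine ⟨r, hrpos, by linarith, H, hHpos, fun h => 1 + c * h - M / 2 * h ^ 2, fun h => c - M * h,
    fun h => -s * (1 + c * h - M / 2 * h ^ 2) - (c - M * h) * p * (1 + h),
    fun h hh => ⟨(hφ h hh).1, (hφ h hh).2.trans (by linarith)⟩, ?_⟩
  rintro h₀ ⟨h₀0, h₀1⟩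
  have hμ : M * h₀ ≤ c / 2 := (mul_le_mul_of_nonneg_left h₀1 hM'.le).trans hH1
  refine ⟨by linarith, fun t h ht hh => ?_⟩
  obtain ⟨e1, e2⟩ := hr₀' t (by
    rw [Metric.mem_ball, dist_zero_right, Real.norm_eq_abs]; linarith)
  have f1 : 1 + p * t + c₀ * t ^ 2 ≤ (1 + t) ^ p := by
    have := (abs_le.1 e1).1
    have e : p * (p - 1) / 2 = 2 * c₀ := by rw [hc₀]; ring
    rw [e] at this
    linarith
  have f2 : (1 + t) ^ (-s) ≤ 1 - s * t + C * t ^ 2 := by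
    have := (abs_le.1 e2).2
    have e : -s * (-s - 1) / 2 = C / 2 := by rw [hC]; ring
    rw [e] at this
    linarith
  obtain ⟨g1, g2⟩ := hφ h hh
  obtain ⟨k, rfl⟩ : ∃ k, h = h₀ + k := ⟨h - h₀, by ring⟩
  set μ := c - M * h₀ with hμd
  have hμ1 : c / 2 ≤ μ := by linarith
  have hμ2 : μ ≤ c := by linarith [mul_nonneg hM'.le h₀0]
  set G := 1 + c * h₀ - M / 2 * h₀ ^ 2 with hG
  have eφ : 1 + c * (h₀ + k) - M / 2 * (h₀ + k) ^ 2 = G + μ * k - M / 2 * k ^ 2 := by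
    rw [hG, hμd]; ring
  show (1 + t) ^ (-s) * (1 + c * (h₀ + k) - M / 2 * (h₀ + k) ^ 2) ≤
    G + (-s * G - μ * p * (1 + h₀)) * t + μ * ((1 + t) ^ p * (1 + (h₀ + k)) - (1 + h₀))
  rw [eφ] at g1 g2 ⊢
  have L : (1 + t) ^ (-s) * (G + μ * k - M / 2 * k ^ 2) ≤
      (1 - s * t) * (G + μ * k - M / 2 * k ^ 2) + 2 * C * t ^ 2 := by
    have a1 := mul_le_mul_of_nonneg_right f2 (by linarith : 0 ≤ G + μ * k - M / 2 * k ^ 2)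
    have a2 : C * t ^ 2 * (G + μ * k - M / 2 * k ^ 2) ≤ C * t ^ 2 * 2 :=
      mul_le_mul_of_nonneg_left (by linarith) (by positivity)
    linarith
  have R : (1 + p * t) * (1 + (h₀ + k)) + c₀ * t ^ 2 ≤ (1 + t) ^ p * (1 + (h₀ + k)) := by
    have h0 := hh.1
    have a1 := mul_le_mul_of_nonneg_right f1 (by linarith : 0 ≤ 1 + (h₀ + k))
    have a2 : 0 ≤ c₀ * t ^ 2 * (h₀ + k) := by positivity
    linarith
  have R' := mul_le_mul_of_nonneg_left R (by linarith : 0 ≤ μ)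
  have b1 : s * t * (M / 2 * k ^ 2) ≤ 1 / 2 * (M / 2 * k ^ 2) := by
    refine mul_le_mul_of_nonneg_right ?_ (by positivity)
    have := mul_le_mul_of_nonneg_left ((le_abs_self t).trans ht) hs.le
    linarith
  have b2 : (2 * C + 1) * t ^ 2 ≤ μ * c₀ * t ^ 2 := by
    refine mul_le_mul_of_nonneg_right ?_ (sq_nonneg t)
    linarith [mul_le_mul_of_nonneg_right hμ1 hc₀'.le]
  have b3 : -(μ * (s + p) * (t * k)) ≤ t ^ 2 + M / 4 * k ^ 2 := by
    have hμM : (μ * (s + p)) ^ 2 ≤ M := by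
      rw [hM, ← mul_pow]
      exact pow_le_pow_left₀ (mul_nonneg (by linarith) (by linarith))
        (mul_le_mul_of_nonneg_right hμ2 (by linarith)) 2
    linarith [sq_nonneg (t + μ * (s + p) / 2 * k),
      mul_le_mul_of_nonneg_right hμM (sq_nonneg k)]
  linarith

/-- The Bellman function `x ^ (-s) * φ (y / x ^ p)` satisfies the main inequality for averages over
`ι`, on the domain `x ^ p ≤ y ≤ D * x ^ p`. -/
theorem exists_bellman_mean (ι : Type*) [Fintype ι] [Nonempty ι] {p s ε : ℝ} (hp : 1 < p)
    (hs : 0 < s) (hε : 0 < ε) :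
    ∃ D > 1, ∃ φ : ℝ → ℝ, (∀ u ∈ Icc 1 D, 1 ≤ φ u ∧ φ u ≤ 1 + ε) ∧
      ∀ (a b : ι → ℝ) (A B : ℝ), (∀ i, 0 ≤ a i) → (∀ i, a i ^ p ≤ b i) →
        (∀ i, b i ≤ D * a i ^ p) → 0 < A → A ^ p ≤ B → B ≤ D * A ^ p →
        ∑ i, a i = Fintype.card ι * A → ∑ i, b i = Fintype.card ι * B →
        (∀ i, 0 < a i) ∧
          ∑ i, a i ^ (-s) * φ (b i / a i ^ p) ≤ Fintype.card ι * (A ^ (-s) * φ (B / A ^ p)) := by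
  obtain ⟨r, hr, hr1, H, hH, φ, μ, α, hφ, hμ⟩ := exists_bellman_profile hp hs hε
  obtain ⟨κ, hκ, hκ'⟩ := Real.exists_one_add_mul_add_le_rpow hp hr hr1
  set N : ℝ := (Fintype.card ι : ℝ) with hN
  have hNpos : 0 < N := by simp [hN, Fintype.card_pos]
  set D := 1 + min H (κ / (2 * N)) with hD
  have hD1 : D - 1 ≤ H := by simp [hD]
  have hD2 : N * D < N + κ := by
    have : min H (κ / (2 * N)) ≤ κ / (2 * N) := min_le_right _ _
    rw [le_div_iff₀ (by positivity)] at this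
    rw [hD]
    linarith
  have hD0 : 0 < min H (κ / (2 * N)) := by positivity
  refine ⟨D, by linarith, fun u => φ (u - 1), ?_, ?_⟩
  · rintro u ⟨h1, h2⟩
    exact hφ _ ⟨by linarith, by linarith⟩
  intro a b A B ha hab hba hA hAB hBA hsa hsb
  have hAp : 0 < A ^ p := Real.rpow_pos_of_pos hA p
  obtain ⟨t, ht⟩ : ∃ t : ι → ℝ, ∀ i, a i = A * (1 + t i) :=
    ⟨fun i => a i / A - 1, fun i => by field_simp; ring⟩
  have ht1 : ∀ i, 0 ≤ 1 + t i := fun i => by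
    have := ha i
    rw [ht i] at this
    exact nonneg_of_mul_nonneg_right this hA
  have hap : ∀ i, a i ^ p = A ^ p * (1 + t i) ^ p := fun i => by
    rw [ht i, Real.mul_rpow hA.le (ht1 i)]
  have hst : ∑ i, t i = 0 := by
    have h : A * (N + ∑ i, t i) = A * N := by
      rw [mul_comm A N, ← hsa, Finset.sum_congr rfl fun i _ => ht i, ← Finset.mul_sum,
        Finset.sum_add_distrib]
      simp [hN]
    have := mul_left_cancel₀ hA.ne' h
    linarith
  have hclose : ∀ i, |t i| ≤ r := by
    intro j
    by_contra! hj
    have h1 : ∑ i, (1 + t i) ^ p ≤ N * D := by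
      have : A ^ p * ∑ i, (1 + t i) ^ p ≤ A ^ p * (N * D) := by
        rw [Finset.mul_sum, ← Finset.sum_congr rfl fun i _ => hap i]
        calc ∑ i, a i ^ p ≤ ∑ i, b i := Finset.sum_le_sum fun i _ => hab i
          _ = N * B := hsb
          _ ≤ N * (D * A ^ p) := by gcongr
          _ = _ := by ring
      exact le_of_mul_le_mul_left this hAp
    have h2 : ∑ i, (1 + p * t i) + κ ≤ ∑ i, (1 + t i) ^ p := by
      classical
      rw [← Finset.add_sum_erase _ _ (Finset.mem_univ j),
        ← Finset.add_sum_erase _ _ (Finset.mem_univ j)]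
      have := hκ' (t j) (by linarith [ht1 j]) hj
      have := Finset.sum_le_sum fun i (_ : i ∈ Finset.univ.erase j) =>
        one_add_mul_self_le_rpow_one_add (by linarith [ht1 i] : -1 ≤ t i) hp.le
      linarith
    rw [Finset.sum_add_distrib, ← Finset.mul_sum, hst] at h2
    simp only [Finset.sum_const, Finset.card_univ, nsmul_eq_mul, mul_one, mul_zero, add_zero] at h2
    linarith
  have ht2 : ∀ i, 0 < 1 + t i := fun i => by linarith [(abs_le.1 (hclose i)).1]
  have hapos : ∀ i, 0 < a i := fun i => by rw [ht i]; exact mul_pos hA (ht2 i)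
  refine ⟨hapos, ?_⟩
  have hh₀ : B / A ^ p - 1 ∈ Icc 0 H := by
    constructor
    · rw [sub_nonneg, one_le_div hAp]; exact hAB
    · have : B / A ^ p ≤ D := by rw [div_le_iff₀ hAp]; exact hBA
      linarith
  have hh : ∀ i, b i / a i ^ p - 1 ∈ Icc 0 H := fun i => by
    have hi := Real.rpow_pos_of_pos (hapos i) p
    constructor
    · rw [sub_nonneg, one_le_div hi]; exact hab i
    · have : b i / a i ^ p ≤ D := by rw [div_le_iff₀ hi]; exact hba i
      linarith
  set h₀ := B / A ^ p - 1
  have hpt : ∀ i, a i ^ (-s) * φ (b i / a i ^ p - 1) ≤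
      A ^ (-s) * (φ h₀ + α h₀ * t i + μ h₀ * (b i / A ^ p - B / A ^ p)) := fun i => by
    have h := (hμ h₀ hh₀).2 (t i) _ (hclose i) (hh i)
    have e1 : (1 + t i) ^ p * (1 + (b i / a i ^ p - 1)) = b i / A ^ p := by
      have : 0 < (1 + t i) ^ p := Real.rpow_pos_of_pos (ht2 i) p
      rw [hap i]
      field_simp
      ring
    have e2 : 1 + h₀ = B / A ^ p := by simp [h₀]
    rw [e1, e2] at h
    have e3 : a i ^ (-s) = A ^ (-s) * (1 + t i) ^ (-s) := by
      rw [ht i, Real.mul_rpow hA.le (ht1 i)]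
    rw [e3, mul_assoc]
    exact mul_le_mul_of_nonneg_left h (Real.rpow_nonneg hA.le _)
  refine (Finset.sum_le_sum fun i _ => hpt i).trans (le_of_eq ?_)
  rw [← Finset.mul_sum, Finset.sum_add_distrib, Finset.sum_add_distrib, ← Finset.mul_sum,
    ← Finset.mul_sum, Finset.sum_sub_distrib, ← Finset.sum_div, hst, hsb]
  simp only [Finset.sum_const, Finset.card_univ, nsmul_eq_mul, ← hN]
  ring

/-- The side-halving child of a cube, with lower left corner `k` and side `ℓ`, selected by `e`. -/
noncomputable def childCorner {n : ℕ} (k : Fin n → ℝ) (ℓ : ℝ) (e : Fin n → Bool) : Fin n → ℝ :=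
  fun i => k i + if e i then ℓ / 2 else 0

/-- The corner of the `m`-th generation dyadic descendant, containing `x`, of a cube. -/
noncomputable def dyadicCorner {n : ℕ} (k : Fin n → ℝ) (ℓ : ℝ) (m : ℕ) (x : Fin n → ℝ) :
    Fin n → ℝ :=
  fun i => k i + ℓ / 2 ^ m * ⌊(x i - k i) * 2 ^ m / ℓ⌋

theorem SubCube.child {n : ℕ} {c k : Fin n → ℝ} {L ℓ : ℝ} (h : SubCube c L k ℓ)
    (e : Fin n → Bool) : SubCube c L (childCorner k ℓ e) (ℓ / 2) := by
  obtain ⟨h0, h1⟩ := h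
  refine ⟨by linarith, fun i => ?_⟩
  have := h1 i
  unfold childCorner
  split_ifs <;> constructor <;> linarith

theorem dyadicCorner_succ {n : ℕ} (k : Fin n → ℝ) {ℓ : ℝ} (hℓ : 0 < ℓ) (m : ℕ)
    (e : Fin n → Bool) (x : Fin n → ℝ) :
    dyadicCorner k ℓ (m + 1) x = dyadicCorner (childCorner k ℓ e) (ℓ / 2) m x := by
  ext i
  unfold dyadicCorner childCorner
  split_ifs
  · have : (x i - (k i + ℓ / 2)) * 2 ^ m / (ℓ / 2) =
        (x i - k i) * 2 ^ (m + 1) / ℓ - ((2 ^ m : ℕ) : ℝ) := by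
      push_cast
      field_simp
      ring
    rw [this, Int.floor_sub_natCast]
    push_cast
    field_simp
    ring
  · have : (x i - (k i + 0)) * 2 ^ m / (ℓ / 2) = (x i - k i) * 2 ^ (m + 1) / ℓ := by
      field_simp
      ring
    rw [this]
    field_simp
    ring

theorem dyadicCorner_zero {n : ℕ} {k x : Fin n → ℝ} {ℓ : ℝ} (hℓ : 0 < ℓ)
    (hx : x ∈ Set.pi Set.univ fun i => Ioo (k i) (k i + ℓ)) : dyadicCorner k ℓ 0 x = k := by
  ext i
  have h := hx i trivial
  have : ⌊(x i - k i) * 2 ^ 0 / ℓ⌋ = 0 := by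
    rw [Int.floor_eq_zero_iff, mem_Ico, le_div_iff₀ hℓ, div_lt_one hℓ]
    constructor <;> linarith [h.1, h.2]
  rw [dyadicCorner, this]
  simp

theorem mem_Icc_dyadicCorner {n : ℕ} (k : Fin n → ℝ) {ℓ : ℝ} (hℓ : 0 < ℓ) (m : ℕ)
    (x : Fin n → ℝ) (i : Fin n) :
    x i ∈ Icc (dyadicCorner k ℓ m x i) (dyadicCorner k ℓ m x i + ℓ / 2 ^ m) := by
  have h1 := Int.floor_le ((x i - k i) * 2 ^ m / ℓ)
  have h2 := (Int.lt_floor_add_one ((x i - k i) * 2 ^ m / ℓ)).le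
  have hc : 0 < ℓ / 2 ^ m := by positivity
  have e : ℓ / 2 ^ m * ((x i - k i) * 2 ^ m / ℓ) = x i - k i := by field_simp
  have h1' := mul_le_mul_of_nonneg_left h1 hc.le
  have h2' := mul_le_mul_of_nonneg_left h2 hc.le
  rw [e] at h1' h2'
  unfold dyadicCorner
  constructor <;> linarith

theorem measurable_comp_dyadicCorner {n : ℕ} (g : (Fin n → ℝ) → ℝ≥0∞) (k : Fin n → ℝ) (ℓ : ℝ)
    (m : ℕ) : Measurable fun x => g (dyadicCorner k ℓ m x) := by
  have h : Measurable fun (x : Fin n → ℝ) (i : Fin n) => ⌊(x i - k i) * 2 ^ m / ℓ⌋ := by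
    refine measurable_pi_lambda _ fun i => Int.measurable_floor.comp ?_
    fun_prop
  exact (measurable_of_countable fun z : Fin n → ℤ => g fun i => k i + ℓ / 2 ^ m * z i).comp h

theorem volume_openCube {n : ℕ} (k : Fin n → ℝ) {ℓ : ℝ} (hℓ : 0 < ℓ) :
    volume (Set.pi Set.univ fun i => Ioo (k i) (k i + ℓ)) = ENNReal.ofReal (ℓ ^ n) := by
  rw [Real.volume_pi_Ioo]
  simp [ENNReal.ofReal_pow hℓ.le]

theorem cubeAvg_eq_lintegral {n : ℕ} (f : (Fin n → ℝ) → ℝ≥0∞) (k : Fin n → ℝ) (ℓ : ℝ) :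
    cubeAvg f k ℓ = ∫⁻ x, f x ∂((ENNReal.ofReal (ℓ ^ n))⁻¹ •
      volume.restrict (Set.pi Set.univ fun i => Ioo (k i) (k i + ℓ))) := by
  rw [lintegral_smul_measure, cubeAvg, div_eq_mul_inv, mul_comm, smul_eq_mul]

theorem cubeAvg_congr {n : ℕ} {f g : (Fin n → ℝ) → ℝ≥0∞} {k : Fin n → ℝ} {ℓ : ℝ}
    (h : EqOn f g (Set.pi Set.univ fun i => Ioo (k i) (k i + ℓ))) :
    cubeAvg f k ℓ = cubeAvg g k ℓ := by
  unfold cubeAvg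
  rw [setLIntegral_congr_fun (MeasurableSet.univ_pi fun i => measurableSet_Ioo) h]

theorem cubeAvg_le_liminf {n : ℕ} {f : (Fin n → ℝ) → ℝ≥0∞} {F : ℕ → (Fin n → ℝ) → ℝ≥0∞}
    (hF : ∀ m, Measurable (F m)) (h : ∀ᵐ x, Tendsto (fun m => F m x) atTop (𝓝 (f x)))
    (k : Fin n → ℝ) (ℓ : ℝ) :
    cubeAvg f k ℓ ≤ liminf (fun m => cubeAvg (F m) k ℓ) atTop := by
  simp only [cubeAvg_eq_lintegral]
  refine le_trans (le_of_eq ?_) (lintegral_liminf_le hF)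
  refine lintegral_congr_ae (Measure.ae_smul_measure (ae_restrict_of_ae ?_) _)
  filter_upwards [h] with x hx
  exact hx.liminf_eq.symm

theorem cubeAvg_const {n : ℕ} (a : ℝ≥0∞) (k : Fin n → ℝ) {ℓ : ℝ} (hℓ : 0 < ℓ) :
    cubeAvg (fun _ => a) k ℓ = a := by
  have h : 0 < ℓ ^ n := by positivity
  rw [cubeAvg, setLIntegral_const, volume_openCube k hℓ, ENNReal.mul_div_cancel_right] <;> simp [h]

theorem cubeAvg_rpow_le {n : ℕ} {f : (Fin n → ℝ) → ℝ≥0∞} (hf : Measurable f) {p : ℝ} (hp : 1 < p)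
    (k : Fin n → ℝ) {ℓ : ℝ} (hℓ : 0 < ℓ) :
    cubeAvg f k ℓ ^ p ≤ cubeAvg (fun x => f x ^ p) k ℓ := by
  have h1 := cubeAvg_const (n := n) 1 k hℓ
  simp only [cubeAvg_eq_lintegral] at h1 ⊢
  have h := ENNReal.lintegral_mul_le_Lp_mul_Lq ((ENNReal.ofReal (ℓ ^ n))⁻¹ •
      volume.restrict (Set.pi Set.univ fun i => Ioo (k i) (k i + ℓ))) (Real.HolderConjugate.conjExponent hp)
    hf.aemeasurable (measurable_const (a := (1 : ℝ≥0∞))).aemeasurable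
  simp only [Pi.mul_apply, mul_one, ENNReal.one_rpow, h1] at h
  rw [one_div, ENNReal.le_rpow_inv_iff (by linarith)] at h
  exact h

theorem setLIntegral_Ioo_eq_Ico {n : ℕ} (f : (Fin n → ℝ) → ℝ≥0∞) (k : Fin n → ℝ) (ℓ : ℝ) :
    ∫⁻ x in Set.pi Set.univ fun i => Ioo (k i) (k i + ℓ), f x =
      ∫⁻ x in Set.pi Set.univ fun i => Ico (k i) (k i + ℓ), f x :=
  setLIntegral_congr (Measure.univ_pi_Ioo_ae_eq_Icc.trans Measure.univ_pi_Ico_ae_eq_Icc.symm)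

theorem cubeAvg_eq_sum_child {n : ℕ} (f : (Fin n → ℝ) → ℝ≥0∞) (k : Fin n → ℝ) {ℓ : ℝ}
    (hℓ : 0 < ℓ) :
    cubeAvg f k ℓ = (2 ^ n)⁻¹ * ∑ e, cubeAvg f (childCorner k ℓ e) (ℓ / 2) := by
  have hU : (Set.pi Set.univ fun i => Ico (k i) (k i + ℓ)) =
      ⋃ e : Fin n → Bool, Set.pi Set.univ fun i =>
        Ico (childCorner k ℓ e i) (childCorner k ℓ e i + ℓ / 2) := by
    ext x
    simp only [Set.mem_pi, mem_univ, true_implies, mem_iUnion, childCorner, mem_Ico]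
    constructor
    · intro h
      refine ⟨fun i => decide (k i + ℓ / 2 ≤ x i), fun i => ?_⟩
      have := h i
      by_cases h' : k i + ℓ / 2 ≤ x i
      · rw [if_pos (decide_eq_true h')]
        constructor <;> linarith
      · simp only [h', decide_false, Bool.false_eq_true, if_false]
        constructor <;> linarith
    · rintro ⟨e, h⟩ i
      have := h i
      split_ifs at this <;> constructor <;> linarith
  have hd : Pairwise (Function.onFun Disjoint fun e : Fin n → Bool => Set.pi Set.univ fun i =>
        Ico (childCorner k ℓ e i) (childCorner k ℓ e i + ℓ / 2)) := by
    intro e e' hne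
    rw [Function.onFun, Set.disjoint_left]
    intro x hx hx'
    apply hne
    ext i
    have h := hx i trivial
    have h' := hx' i trivial
    simp only [childCorner, mem_Ico] at h h'
    cases he : e i <;> cases he' : e' i <;> simp only [he, he'] at h h' ⊢ <;> simp at h h' <;>
      linarith
  have hint : ∫⁻ x in Set.pi Set.univ fun i => Ioo (k i) (k i + ℓ), f x =
      ∑ e, ∫⁻ x in Set.pi Set.univ fun i =>
        Ioo (childCorner k ℓ e i) (childCorner k ℓ e i + ℓ / 2), f x := by
    rw [setLIntegral_Ioo_eq_Ico, hU,
      lintegral_iUnion (fun e => MeasurableSet.univ_pi fun i => measurableSet_Ico) hd, tsum_fintype]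
    simp_rw [setLIntegral_Ioo_eq_Ico]
  have hvol : ENNReal.ofReal (ℓ ^ n) = 2 ^ n * ENNReal.ofReal ((ℓ / 2) ^ n) := by
    rw [show ℓ ^ n = 2 ^ n * (ℓ / 2) ^ n by rw [← mul_pow]; congr 1; ring,
      ENNReal.ofReal_mul (by positivity), ENNReal.ofReal_pow (by norm_num)]
    simp
  simp only [cubeAvg]
  simp only [ENNReal.div_eq_inv_mul]
  rw [← Finset.mul_sum, ← hint, hvol, ENNReal.mul_inv (by simp) (by simp)]
  ring

theorem ae_tendsto_cubeAvg_dyadicCorner {n : ℕ} {f : (Fin n → ℝ) → ℝ≥0∞} (hf : Measurable f)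
    (hfin : ∫⁻ x, f x ≠ ⊤) (k : Fin n → ℝ) {ℓ : ℝ} (hℓ : 0 < ℓ) :
    ∀ᵐ x, Tendsto (fun m : ℕ => cubeAvg f (dyadicCorner k ℓ m x) (ℓ / 2 ^ m)) atTop
      (𝓝 (f x)) := by
  filter_upwards [(IsUnifLocDoublingMeasure.vitaliFamily
    (volume : Measure (Fin n → ℝ)) 1).ae_tendsto_lintegral_div hf.aemeasurable hfin] with x hx
  have hlim : Tendsto (fun m : ℕ => ℓ / 2 ^ m / 2) atTop (𝓝[>] 0) := by
    refine tendsto_nhdsWithin_iff.2 ⟨?_, .of_forall fun m => by simp; positivity⟩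
    have := (tendsto_pow_atTop_nhds_zero_of_lt_one (r := (1 / 2 : ℝ)) (by norm_num)
      (by norm_num)).const_mul (ℓ / 2)
    simp only [mul_zero] at this
    refine this.congr fun m => ?_
    rw [div_pow, one_pow]
    ring
  have hball : ∀ m : ℕ, Metric.closedBall (fun i => dyadicCorner k ℓ m x i + ℓ / 2 ^ m / 2)
      (ℓ / 2 ^ m / 2) = Icc (dyadicCorner k ℓ m x) fun i => dyadicCorner k ℓ m x i + ℓ / 2 ^ m := by
    intro m
    rw [closedBall_pi _ (by positivity), ← pi_univ_Icc]
    refine pi_congr rfl fun i _ => ?_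
    rw [Real.closedBall_eq_Icc]
    congr 1 <;> ring
  have := hx.comp (IsUnifLocDoublingMeasure.tendsto_closedBall_filterAt volume
    (fun m => fun i => dyadicCorner k ℓ m x i + ℓ / 2 ^ m / 2) _ hlim (.of_forall fun m => ?_))
  · refine this.congr fun m => ?_
    have hpos : 0 < ℓ / 2 ^ m := by positivity
    have hae : (Set.pi Set.univ fun i =>
        Ioo (dyadicCorner k ℓ m x i) (dyadicCorner k ℓ m x i + ℓ / 2 ^ m)) =ᵐ[volume]
        Icc (dyadicCorner k ℓ m x) fun i => dyadicCorner k ℓ m x i + ℓ / 2 ^ m :=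
      Measure.univ_pi_Ioo_ae_eq_Icc
    simp only [Function.comp_apply, hball m]
    rw [cubeAvg, setLIntegral_congr hae, ← volume_openCube _ hpos, measure_congr hae]
  · rw [one_mul, hball, ← pi_univ_Icc]
    exact fun i _ => mem_Icc_dyadicCorner k hℓ m x i

/-- The averages of `(dyadic averages of w) ^ (-s)` are controlled by the Bellman function. -/
theorem cubeAvg_dyadic_rpow_le {n : ℕ} {p s D : ℝ} (hp : 1 < p) {φ : ℝ → ℝ}
    (hφ : ∀ u ∈ Icc 1 D, 1 ≤ φ u)
    (hB : ∀ (a b : (Fin n → Bool) → ℝ) (A B : ℝ), (∀ i, 0 ≤ a i) → (∀ i, a i ^ p ≤ b i) →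
        (∀ i, b i ≤ D * a i ^ p) → 0 < A → A ^ p ≤ B → B ≤ D * A ^ p →
        ∑ i, a i = Fintype.card (Fin n → Bool) * A →
        ∑ i, b i = Fintype.card (Fin n → Bool) * B →
        (∀ i, 0 < a i) ∧ ∑ i, a i ^ (-s) * φ (b i / a i ^ p) ≤
          Fintype.card (Fin n → Bool) * (A ^ (-s) * φ (B / A ^ p)))
    {c : Fin n → ℝ} {L : ℝ} {w : (Fin n → ℝ) → ℝ≥0∞} (hw : Measurable w)
    (hfin : ∀ k ℓ, SubCube c L k ℓ → cubeAvg w k ℓ ≠ ⊤)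
    (hD : 0 ≤ D) (hRH : ∀ k ℓ, SubCube c L k ℓ →
        cubeAvg (fun x => w x ^ p) k ℓ ≤ ENNReal.ofReal D * (cubeAvg w k ℓ) ^ p) (m : ℕ) :
    ∀ k ℓ, SubCube c L k ℓ → cubeAvg w k ℓ ≠ 0 →
      cubeAvg (fun x => cubeAvg w (dyadicCorner k ℓ m x) (ℓ / 2 ^ m) ^ (-s)) k ℓ ≤
        ENNReal.ofReal ((cubeAvg w k ℓ).toReal ^ (-s) *
          φ ((cubeAvg (fun x => w x ^ p) k ℓ).toReal / (cubeAvg w k ℓ).toReal ^ p)) := by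
  have hp0 : 0 ≤ p := by linarith
  have hfinp : ∀ k ℓ, SubCube c L k ℓ → cubeAvg (fun x => w x ^ p) k ℓ ≠ ⊤ := fun k ℓ h =>
    ne_top_of_le_ne_top (ENNReal.mul_ne_top ofReal_ne_top
      (ENNReal.rpow_ne_top_of_nonneg hp0 (hfin k ℓ h))) (hRH k ℓ h)
  have hlow : ∀ k ℓ, SubCube c L k ℓ →
      (cubeAvg w k ℓ).toReal ^ p ≤ (cubeAvg (fun x => w x ^ p) k ℓ).toReal := fun k ℓ h => by
    rw [ENNReal.toReal_rpow]
    exact ENNReal.toReal_mono (hfinp k ℓ h) (cubeAvg_rpow_le hw hp k h.1)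
  have hupp : ∀ k ℓ, SubCube c L k ℓ →
      (cubeAvg (fun x => w x ^ p) k ℓ).toReal ≤ D * (cubeAvg w k ℓ).toReal ^ p := fun k ℓ h => by
    have := ENNReal.toReal_mono (ENNReal.mul_ne_top ofReal_ne_top
      (ENNReal.rpow_ne_top_of_nonneg hp0 (hfin k ℓ h))) (hRH k ℓ h)
    rwa [ENNReal.toReal_mul, ENNReal.toReal_ofReal hD, ← ENNReal.toReal_rpow] at this
  induction m with
  | zero =>
    intro k ℓ h h0
    have hpos := ENNReal.toReal_pos h0 (hfin k ℓ h)
    have hpp := Real.rpow_pos_of_pos hpos p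
    rw [cubeAvg_congr (g := fun _ => cubeAvg w k ℓ ^ (-s)) fun x hx => by
      simp [dyadicCorner_zero h.1 hx], cubeAvg_const _ _ h.1]
    conv_lhs => rw [← ENNReal.ofReal_toReal (hfin k ℓ h), ENNReal.ofReal_rpow_of_pos hpos]
    refine ENNReal.ofReal_le_ofReal (le_mul_of_one_le_right (Real.rpow_nonneg hpos.le _) (hφ _ ?_))
    exact ⟨by rw [one_le_div hpp]; exact hlow k ℓ h, by rw [div_le_iff₀ hpp]; exact hupp k ℓ h⟩
  | succ m ih =>
    intro k ℓ h h0
    have hpos := ENNReal.toReal_pos h0 (hfin k ℓ h)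
    have hcard : (Fintype.card (Fin n → Bool) : ℝ) = 2 ^ n := by simp
    have hsum : ∀ f : (Fin n → ℝ) → ℝ≥0∞, (∀ k ℓ, SubCube c L k ℓ → cubeAvg f k ℓ ≠ ⊤) →
        ∑ e, (cubeAvg f (childCorner k ℓ e) (ℓ / 2)).toReal =
          Fintype.card (Fin n → Bool) * (cubeAvg f k ℓ).toReal := fun f hf => by
      rw [cubeAvg_eq_sum_child f k h.1, ENNReal.toReal_mul,
        ENNReal.toReal_sum fun e _ => hf _ _ (h.child e), hcard]
      simp
    obtain ⟨hchild, hle⟩ := hB (fun e => (cubeAvg w (childCorner k ℓ e) (ℓ / 2)).toReal)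
      (fun e => (cubeAvg (fun x => w x ^ p) (childCorner k ℓ e) (ℓ / 2)).toReal) _ _
      (fun e => ENNReal.toReal_nonneg) (fun e => hlow _ _ (h.child e))
      (fun e => hupp _ _ (h.child e)) hpos (hlow k ℓ h) (hupp k ℓ h) (hsum w hfin) (hsum _ hfinp)
    have hφ' : ∀ e, 0 ≤ (cubeAvg w (childCorner k ℓ e) (ℓ / 2)).toReal ^ (-s) *
        φ ((cubeAvg (fun x => w x ^ p) (childCorner k ℓ e) (ℓ / 2)).toReal /
          (cubeAvg w (childCorner k ℓ e) (ℓ / 2)).toReal ^ p) := fun e => by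
      have hpp := Real.rpow_pos_of_pos (hchild e) p
      refine mul_nonneg (Real.rpow_nonneg (hchild e).le _) (zero_le_one.trans (hφ _ ?_))
      exact ⟨by rw [one_le_div hpp]; exact hlow _ _ (h.child e),
        by rw [div_le_iff₀ hpp]; exact hupp _ _ (h.child e)⟩
    rw [cubeAvg_eq_sum_child _ k h.1]
    calc _ ≤ (2 ^ n)⁻¹ * ∑ e, ENNReal.ofReal
          ((cubeAvg w (childCorner k ℓ e) (ℓ / 2)).toReal ^ (-s) *
            φ ((cubeAvg (fun x => w x ^ p) (childCorner k ℓ e) (ℓ / 2)).toReal /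
              (cubeAvg w (childCorner k ℓ e) (ℓ / 2)).toReal ^ p)) := by
          gcongr with e
          have hside : ℓ / 2 ^ (m + 1) = ℓ / 2 / 2 ^ m := by rw [pow_succ]; field_simp
          simp only [dyadicCorner_succ k h.1 m e, hside]
          exact ih _ _ (h.child e) fun h0' => (hchild e).ne' (by simp [h0'])
      _ ≤ (2 ^ n)⁻¹ * ENNReal.ofReal (2 ^ n * ((cubeAvg w k ℓ).toReal ^ (-s) *
            φ ((cubeAvg (fun x => w x ^ p) k ℓ).toReal / (cubeAvg w k ℓ).toReal ^ p))) := by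
          rw [← ENNReal.ofReal_sum_of_nonneg fun e _ => hφ' e]
          rw [hcard] at hle
          gcongr
      _ = _ := by
          rw [ENNReal.ofReal_mul (by positivity), ENNReal.ofReal_pow (by norm_num), ← mul_assoc]
          simp only [ofReal_ofNat]
          rw [ENNReal.inv_mul_cancel (by simp) (by simp), one_mul]

/-- A reverse Hölder inequality with constant close to `1` bounds the averages of negative powers. -/
theorem exists_reverseHolder_imp_muckenhoupt (n : ℕ) {p s ε : ℝ} (hp : 1 < p) (hs : 0 < s)
    (hε : 0 < ε) :
    ∃ D > 1, ∀ (c : Fin n → ℝ) (L : ℝ) (w : (Fin n → ℝ) → ℝ≥0∞), Measurable w →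
      ∫⁻ x, w x ≠ ⊤ →
      (∀ k ℓ, SubCube c L k ℓ →
        cubeAvg (fun x => w x ^ p) k ℓ ≤ ENNReal.ofReal D * (cubeAvg w k ℓ) ^ p) →
      ∀ k ℓ, SubCube c L k ℓ → cubeAvg w k ℓ ≠ 0 →
        cubeAvg (fun x => w x ^ (-s)) k ℓ ≤ cubeAvg w k ℓ ^ (-s) * ENNReal.ofReal (1 + ε) := by
  obtain ⟨D, hD, φ, hφ, hB⟩ := exists_bellman_mean (Fin n → Bool) hp hs hε
  refine ⟨D, hD, fun c L w hw hwfin hRH k ℓ h h0 => ?_⟩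
  have hfin : ∀ k ℓ, SubCube c L k ℓ → cubeAvg w k ℓ ≠ ⊤ := fun k ℓ h =>
    (ENNReal.div_lt_top (ne_top_of_le_ne_top hwfin (setLIntegral_le_lintegral _ _))
      (by simpa using pow_pos h.1 n)).ne
  have hm := fun m => cubeAvg_dyadic_rpow_le hp (fun u hu => (hφ u hu).1) hB hw hfin
    (by linarith) hRH m k ℓ h h0
  have hpos := ENNReal.toReal_pos h0 (hfin k ℓ h)
  have hbd : ∀ m : ℕ, cubeAvg (fun x => cubeAvg w (dyadicCorner k ℓ m x) (ℓ / 2 ^ m) ^ (-s)) k ℓ ≤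
      cubeAvg w k ℓ ^ (-s) * ENNReal.ofReal (1 + ε) := fun m => by
    refine (hm m).trans ?_
    rw [ENNReal.ofReal_mul (Real.rpow_nonneg hpos.le _), ← ENNReal.ofReal_rpow_of_pos hpos,
      ENNReal.ofReal_toReal (hfin k ℓ h)]
    gcongr
    refine (hφ _ ?_).2
    have hpp := Real.rpow_pos_of_pos hpos p
    have hub : cubeAvg (fun x => w x ^ p) k ℓ ≤ ENNReal.ofReal D * (cubeAvg w k ℓ) ^ p := hRH k ℓ h
    have htop : ENNReal.ofReal D * (cubeAvg w k ℓ) ^ p ≠ ⊤ := ENNReal.mul_ne_top ofReal_ne_top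
      (ENNReal.rpow_ne_top_of_nonneg (by linarith) (hfin k ℓ h))
    constructor
    · rw [one_le_div hpp, ENNReal.toReal_rpow]
      exact ENNReal.toReal_mono (ne_top_of_le_ne_top htop hub) (cubeAvg_rpow_le hw hp k h.1)
    · rw [div_le_iff₀ hpp]
      have := ENNReal.toReal_mono htop hub
      rwa [ENNReal.toReal_mul, ENNReal.toReal_ofReal (by linarith), ← ENNReal.toReal_rpow] at this
  refine le_trans ?_ (liminf_le_of_frequently_le' (f := atTop) (Frequently.of_forall hbd))
  refine cubeAvg_le_liminf (fun m =>
    measurable_comp_dyadicCorner (fun y => cubeAvg w y (ℓ / 2 ^ m) ^ (-s)) k ℓ m) ?_ k ℓ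
  filter_upwards [ae_tendsto_cubeAvg_dyadicCorner hw hwfin k h.1] with x hx
  exact (((ENNReal.continuous_rpow_const (y := -s)).tendsto _).comp hx)

theorem statement9 (n : ℕ) (hn : 1 < n) (c : Fin n → ℝ) (L : ℝ) (hL : 0 < L)
    (p q η : ℝ) (hp : 1 < p) (hq : 1 < q) (hη : 1 < η) :
    ∃ δ : ℝ, 1 < δ ∧ ∀ w : (Fin n → ℝ) → ℝ≥0∞, Measurable w →
      (∫⁻ x in Set.pi Set.univ fun i => Set.Ioo (c i) (c i + L), w x) ≠ ⊤ →
      (∀ k ℓ, SubCube c L k ℓ →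
        cubeAvg (fun x => w x ^ p) k ℓ ≤ ENNReal.ofReal δ ^ p * (cubeAvg w k ℓ) ^ p) →
      ∀ k ℓ, SubCube c L k ℓ →
        cubeAvg w k ℓ * (cubeAvg (fun x => w x ^ (1 - q / (q - 1))) k ℓ) ^ (q - 1)
          ≤ ENNReal.ofReal η := by
  have hq' : 0 < q - 1 := by linarith
  have hp' : 0 < p := by linarith
  set s := (q - 1)⁻¹ with hs
  have hspos : 0 < s := by positivity
  have hη1 : 1 < η ^ s := Real.one_lt_rpow hη hspos
  obtain ⟨D, hD, hmain⟩ :=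
    exists_reverseHolder_imp_muckenhoupt n hp hspos (sub_pos.2 hη1)
  refine ⟨D ^ p⁻¹, Real.one_lt_rpow hD (by positivity), fun w hw hwfin hRH k ℓ h => ?_⟩
  have hδ : ENNReal.ofReal (D ^ p⁻¹) ^ p = ENNReal.ofReal D := by
    rw [ENNReal.ofReal_rpow_of_nonneg (by positivity) hp'.le, Real.rpow_inv_rpow (by linarith) hp'.ne']
  have hexp : 1 - q / (q - 1) = -s := by rw [hs]; field_simp; ring
  rw [hδ] at hRH
  rw [hexp]
  set S := Set.pi Set.univ fun i => Set.Ioo (c i) (c i + L) with hS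
  have hSm : MeasurableSet S := MeasurableSet.univ_pi fun i => measurableSet_Ioo
  have hsub : ∀ k ℓ, SubCube c L k ℓ → EqOn (S.indicator w) w
      (Set.pi Set.univ fun i => Set.Ioo (k i) (k i + ℓ)) := fun k ℓ h x hx => by
    refine indicator_of_mem (fun i _ => ?_) w
    have := h.2 i
    have := hx i trivial
    exact ⟨by linarith [this.1], by linarith [this.2]⟩
  have hsub' : ∀ (r : ℝ) k ℓ, SubCube c L k ℓ → cubeAvg (fun x => S.indicator w x ^ r) k ℓ =
      cubeAvg (fun x => w x ^ r) k ℓ := fun r k ℓ h =>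
    cubeAvg_congr fun x hx => by simp only [hsub k ℓ h hx]
  have key := hmain c L (S.indicator w) (hw.indicator hSm)
    (by rwa [lintegral_indicator hSm]) (fun k ℓ h => by
      rw [hsub' p k ℓ h, cubeAvg_congr (hsub k ℓ h)]; exact hRH k ℓ h) k ℓ h
  rw [hsub' _ k ℓ h, cubeAvg_congr (hsub k ℓ h)] at key
  have hfin : cubeAvg w k ℓ ≠ ⊤ := by
    rw [← cubeAvg_congr (hsub k ℓ h)]
    refine (ENNReal.div_lt_top (ne_top_of_le_ne_top hwfin ?_) (by simpa using pow_pos h.1 n)).ne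
    rw [← lintegral_indicator hSm]
    exact setLIntegral_le_lintegral _ _
  by_cases h0 : cubeAvg w k ℓ = 0
  · simp [h0]
  calc _ ≤ cubeAvg w k ℓ * (cubeAvg w k ℓ ^ (-s) * ENNReal.ofReal (1 + (η ^ s - 1))) ^ (q - 1) := by
        gcongr
        exact key h0
    _ = ENNReal.ofReal η := by
        rw [ENNReal.mul_rpow_of_nonneg _ _ hq'.le, ← ENNReal.rpow_mul,
          show -s * (q - 1) = -1 by rw [hs]; field_simp, ENNReal.rpow_neg_one, ← mul_assoc,
          ENNReal.mul_inv_cancel h0 hfin, one_mul, add_sub_cancel,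
          ENNReal.ofReal_rpow_of_nonneg (by positivity) hq'.le, hs,
          Real.rpow_inv_rpow (by linarith) hq'.ne']
end
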